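/- arXiv:2412.07047 — 2 statements merged into one kernel-verified Lean document; each statement's English description precedes it below -/
import Mathlib

section
/- Let (X, μ, E) be an ergodic mcp CBER of type III and let F ⊆ E be a subrelation which is itself an ergodic mcp CBER of type III. Let 𝒜 ⊆ E − Δ (where Δ = {(x,x) : x ∈ X}) be a Borel set of directed edges which is non-null with respect to ν_l, and let A ⊆ X be a non-null Borel set. Then there exists a Borel bijection φ : 𝒜 → A (defined up to null sets) such that (φ(e), s(e)) ∈ F for almost every e ∈ 𝒜, where s(e) denotes the first coordinate of e. -/
open MeasureTheory Set Filter
open scoped ENNReal ENat Topology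

noncomputable section

variable {X : Type*}

/-- The integral of `f` over the set of edges `A` against the "left" measure `ν_l`
determined by `μ`:  `∫ₐ f dν_l = ∫ₓ Σ_{y : (x,y) ∈ A} f(x,y) dμ(x)`. -/
def lintL [MeasurableSpace X] (μ : Measure X) (f : X × X → ℝ≥0∞) (A : Set (X × X)) : ℝ≥0∞ :=
  ∫⁻ x, ∑' y : {y : X // (x, y) ∈ A}, f (x, (y : X)) ∂μ

/-- The integral of `f` over the set of edges `A` against the "right" measure `ν_r`
determined by `μ`:  `∫ₐ f dν_r = ∫ₓ Σ_{y : (y,x) ∈ A} f(y,x) dμ(x)`. -/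
def lintR [MeasurableSpace X] (μ : Measure X) (f : X × X → ℝ≥0∞) (A : Set (X × X)) : ℝ≥0∞ :=
  ∫⁻ x, ∑' y : {y : X // (y, x) ∈ A}, f ((y : X), x) ∂μ

/-- `ν_l(A) = ∫ₓ |{y : (x,y) ∈ A}| dμ(x)`. -/
def nuL [MeasurableSpace X] (μ : Measure X) (A : Set (X × X)) : ℝ≥0∞ :=
  lintL μ (fun _ => 1) A

/-- `ν_r(A) = ∫ₓ |{y : (y,x) ∈ A}| dμ(x)`. -/
def nuR [MeasurableSpace X] (μ : Measure X) (A : Set (X × X)) : ℝ≥0∞ :=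
  lintR μ (fun _ => 1) A

/-- `E` is measure-class-preserving w.r.t. `μ`: `ν_l` and `ν_r` are mutually absolutely
continuous on Borel subsets of `E`. -/
def MCP [MeasurableSpace X] (μ : Measure X) (E : Set (X × X)) : Prop :=
  ∀ A : Set (X × X), A ⊆ E → MeasurableSet A → (nuL μ A = 0 ↔ nuR μ A = 0)

/-- `E` is measure-preserving w.r.t. `μ`: `ν_l = ν_r` on Borel subsets of `E`. -/
def MPrel [MeasurableSpace X] (μ : Measure X) (E : Set (X × X)) : Prop :=
  ∀ A : Set (X × X), A ⊆ E → MeasurableSet A → nuL μ A = nuR μ A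

/-- A countable Borel equivalence relation: a Borel equivalence relation all of whose
classes are countable. -/
def IsCBER [MeasurableSpace X] (E : Set (X × X)) : Prop :=
  MeasurableSet E ∧ Equivalence (fun x y => (x, y) ∈ E) ∧
    ∀ x : X, {y | (x, y) ∈ E}.Countable

/-- The `E`-saturation of a set `A`. -/
def ESat (E : Set (X × X)) (A : Set X) : Set X :=
  {x | ∃ y ∈ A, (x, y) ∈ E}

/-- `E` is ergodic w.r.t. `μ`: every non-null Borel set is a complete section. -/
def ErgodicRel [MeasurableSpace X] (μ : Measure X) (E : Set (X × X)) : Prop :=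
  ∀ A : Set X, MeasurableSet A → μ A ≠ 0 → μ (ESat E A)ᶜ = 0

/-- `E` is properly ergodic: ergodic, and `μ` is not concentrated on a single `E`-class. -/
def ProperlyErgodicRel [MeasurableSpace X] (μ : Measure X) (E : Set (X × X)) : Prop :=
  ErgodicRel μ E ∧ ∀ x : X, μ {y | (x, y) ∉ E} ≠ 0

/-- `μ'` is `E`-invariant: every Borel bijection between Borel subsets whose graph is
contained in `E` pushes the restricted measure forward to the restricted measure. -/
def InvariantUnder [MeasurableSpace X] (μ' : Measure X) (E : Set (X × X)) : Prop :=
  ∀ (f : X → X) (A : Set X), Measurable f → MeasurableSet A → Set.InjOn f A →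
    (∀ x ∈ A, (x, f x) ∈ E) →
    Measure.map f (μ'.restrict A) = μ'.restrict (f '' A)

/-- Mutual absolute continuity of measures. -/
def EquivMeasure [MeasurableSpace X] (μ' μ : Measure X) : Prop :=
  μ' ≪ μ ∧ μ ≪ μ'

/-- Type II: `μ` is non-atomic and some σ-finite measure equivalent to `μ` is `E`-invariant. -/
def IsTypeII [MeasurableSpace X] (μ : Measure X) (E : Set (X × X)) : Prop :=
  NoAtoms μ ∧
    ∃ μ' : Measure X, SigmaFinite μ' ∧ EquivMeasure μ' μ ∧ InvariantUnder μ' E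

/-- Type III: no σ-finite measure equivalent to `μ` is `E`-invariant. -/
def IsTypeIII [MeasurableSpace X] (μ : Measure X) (E : Set (X × X)) : Prop :=
  ¬ ∃ μ' : Measure X, SigmaFinite μ' ∧ EquivMeasure μ' μ ∧ InvariantUnder μ' E

/-- `w` is (a pointwise-cocycle version of) the Radon–Nikodym cocycle `𝔴 = dν_l/dν_r` of the
mcp relation `E`: it is Borel, takes values in `(0,∞)` on `E`, satisfies the cocycle identity,
and `ν_l(A) = ∫_A w dν_r` for every Borel `A ⊆ E`. -/
def IsRNCocycle [MeasurableSpace X] (μ : Measure X) (E : Set (X × X))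
    (w : X × X → ℝ≥0∞) : Prop :=
  Measurable w ∧
  (∀ e ∈ E, w e ≠ 0 ∧ w e ≠ ∞) ∧
  (∀ x y z : X, (y, x) ∈ E → (z, y) ∈ E → w (z, y) * w (y, x) = w (z, x)) ∧
  (∀ x : X, w (x, x) = 1) ∧
  ∀ A : Set (X × X), A ⊆ E → MeasurableSet A → nuL μ A = lintR μ w A

/-- The connectedness relation of a graph `G`: `x` and `y` are related iff they are joined
by a path of edges of `G`. -/
def connRel (G : Set (X × X)) : Set (X × X) :=
  {p | Relation.ReflTransGen (fun a b => (a, b) ∈ G) p.1 p.2}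

/-- The symmetrization of a directed graph. -/
def symmCl (G : Set (X × X)) : Set (X × X) :=
  {p | p ∈ G ∨ (p.2, p.1) ∈ G}

/-- The graph distance in `G` (with value `⊤` between distinct components). -/
def gdist (G : Set (X × X)) (x y : X) : ℕ∞ :=
  sInf ((fun m : ℕ => (m : ℕ∞)) ''
    {m : ℕ | ∃ c : ℕ → X, c 0 = x ∧ c m = y ∧ ∀ i < m, (c i, c (i + 1)) ∈ G})

/-- For a directed edge `(x,y)` of an acyclic graph `G`, the half-space
`N_{(x,y)} = {z : d_G(y,z) < d_G(x,z)}`. -/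
def halfSpace (G : Set (X × X)) (x y : X) : Set X :=
  {z | gdist G y z < gdist G x z}

/-- A geodesic ray in `G`. -/
def IsGeodesicRay (G : Set (X × X)) (r : ℕ → X) : Prop :=
  (∀ i : ℕ, (r i, r (i + 1)) ∈ G) ∧
    ∀ i j : ℕ, i ≤ j → gdist G (r i) (r j) = ((j - i : ℕ) : ℕ∞)

/-- The end represented by the geodesic ray `r` is vanishing w.r.t. the cocycle `w`:
`sup {w(y, r 0) : y ∈ N_{(r i, r (i+1))}} → 0` as `i → ∞`. -/
def VanishingEnd (w : X × X → ℝ≥0∞) (G : Set (X × X)) (r : ℕ → X) : Prop :=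
  Tendsto (fun i : ℕ => ⨆ y ∈ halfSpace G (r i) (r (i + 1)), w (y, r 0))
    atTop (nhds 0)

/-- A (symmetric) graph is acyclic if it has no injective cycle of length `≥ 3`. -/
def AcyclicGraph (G : Set (X × X)) : Prop :=
  ∀ (n : ℕ) (c : ℕ → X), 2 < n → (∀ i < n, (c i, c ((i + 1) % n)) ∈ G) →
    ¬ Function.Injective fun i : Fin n => c (i : ℕ)

/-- Amenability of a locally countable Borel graph `G` (w.r.t. the measure `μ`):
there are Borel a.e.-averaging functions `λ_n` on the connectedness relation of `G`. -/
def AmenableGraph [MeasurableSpace X] (μ : Measure X) (G : Set (X × X)) : Prop :=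
  ∃ lam : ℕ → X × X → ℝ,
    (∀ n, Measurable (lam n)) ∧
    (∀ n e, 0 ≤ lam n e) ∧
    (∀ᵐ x ∂μ, ∀ n : ℕ, ∑' y : {y : X // (x, y) ∈ connRel G}, lam n (x, (y : X)) = 1) ∧
    nuL μ {e ∈ G | ¬ Tendsto
        (fun n : ℕ => ∑' z : {z : X // (e.1, z) ∈ connRel G},
          |lam n (e.1, (z : X)) - lam n (e.2, (z : X))|)
        atTop (nhds 0)} = 0

/-- The Schreier graph of an action of a free group, with respect to the free basis. -/
def schreier {ι : Type*} [MeasurableSpace X] (φ : FreeGroup ι →* Equiv.Perm X) :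
    Set (X × X) :=
  {p | p.1 ≠ p.2 ∧ ∃ s : ι,
    φ (FreeGroup.of s) p.1 = p.2 ∨ φ (FreeGroup.of s) p.2 = p.1}

namespace EVB

/-- countable unions of Borel sets on which `π` is injective -/
def Sml {Y X : Type*} [MeasurableSpace Y] (π : Y → X) (S : Set Y) : Prop :=
  ∃ 𝒢 : Set (Set Y), 𝒢.Countable ∧ (∀ G ∈ 𝒢, MeasurableSet G ∧ InjOn π G) ∧ S = ⋃₀ 𝒢

theorem Sml.meas {Y X : Type*} [MeasurableSpace Y] {π : Y → X} {S : Set Y} (h : Sml π S) :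
    MeasurableSet S := by
  obtain ⟨G, hc, hG, rfl⟩ := h
  exact MeasurableSet.sUnion hc fun t ht => (hG t ht).1

theorem Sml.iUnion {ι : Type*} [Countable ι] {Y X : Type*} [MeasurableSpace Y] {π : Y → X}
    {S : ι → Set Y} (h : ∀ i, Sml π (S i)) : Sml π (⋃ i, S i) := by
  choose G hc hG hS using h
  refine ⟨⋃ i, G i, countable_iUnion hc, ?_, ?_⟩
  · intro g hg
    obtain ⟨i, hi⟩ := mem_iUnion.1 hg
    exact hG i g hi
  · rw [sUnion_iUnion]; exact iUnion_congr hS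

theorem Sml.union {Y X : Type*} [MeasurableSpace Y] {π : Y → X}
    {S T : Set Y} (h : Sml π S) (h' : Sml π T) : Sml π (S ∪ T) := by
  rw [union_eq_iUnion]
  exact Sml.iUnion (fun b => by cases b <;> simpa)

theorem Sml.inj {Y X : Type*} [MeasurableSpace Y] {π : Y → X}
    {S : Set Y} (h : MeasurableSet S) (h' : InjOn π S) : Sml π S :=
  ⟨{S}, countable_singleton _, by simp [h, h'], by simp⟩

def Bad {Y X : Type*} [MeasurableSpace Y] (π : Y → X) (n : ℕ) (B : ℕ → Set Y) : Prop :=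
  ∃ S : ℕ → Set Y, (∀ i, Sml π (S i)) ∧ ∀ x, ¬ ∀ i ≤ n, ∃ y ∈ B i \ S i, π y = x

section
variable {Y X : Type*} [MetricSpace Y] [SecondCountableTopology Y] [CompleteSpace Y]
  [MeasurableSpace Y] [BorelSpace Y]
  [TopologicalSpace X] [PolishSpace X] [MeasurableSpace X] [BorelSpace X]

theorem bad_step {π : Y → X} (hπ : Continuous π) {n : ℕ} {B : ℕ → Set Y}
    (hB : ¬ Bad π n B) (hm : ∀ i, MeasurableSet (B i)) {k : ℕ} (hk : k ≤ n) (N : ℕ) :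
    ∃ U V : Set Y, IsClosed U ∧ IsClosed V ∧ Disjoint U V ∧
      (∀ u ∈ U, ∀ u' ∈ U, dist u u' ≤ 2 / (N + 1)) ∧
      ¬ Bad π (n+1) (fun i => if i = n+1 then B k ∩ V else if i = k then B k ∩ U else B i) := by
  rcases isEmpty_or_nonempty Y with hY | hY
  · exact absurd ⟨fun _ => ∅, fun i => Sml.inj MeasurableSet.empty (injOn_empty _),
      fun x h => by obtain ⟨y, _⟩ := h 0 (Nat.zero_le _); exact hY.elim y⟩ hB
  by_contra! hcon
  let d := TopologicalSpace.denseSeq Y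
  let cb : ℕ → ℕ → Set Y := fun i M => Metric.closedBall (d i) (1 / (M + 1))
  let ι := {t : ℕ × ℕ × ℕ // N ≤ t.2.2 ∧ Disjoint (cb t.1 t.2.2) (cb t.2.1 t.2.2)}
  have key : ∀ t : ι, Bad π (n+1) (fun i => if i = n+1 then B k ∩ cb t.1.2.1 t.1.2.2
      else if i = k then B k ∩ cb t.1.1 t.1.2.2 else B i) := by
    rintro ⟨⟨i, j, M⟩, hM, hd⟩
    refine hcon _ _ Metric.isClosed_closedBall Metric.isClosed_closedBall hd ?_
    intro u hu u' hu'
    simp only [cb, Metric.mem_closedBall] at hu hu'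
    have h1 := dist_triangle_right u u' (d i)
    have h2 : (1:ℝ) / (M+1) ≤ 1 / (N+1) := by
      apply one_div_le_one_div_of_le (by positivity)
      simpa using hM
    have h3 : (2:ℝ) / (N+1) = 1/(N+1) + 1/(N+1) := by ring
    linarith
  choose S hS hSx using key
  let S0 : ℕ → Set Y := fun i => ⋃ t, (S t i ∪ S t (n+1))
  have hS0 : ∀ i, Sml π (S0 i) := fun i => Sml.iUnion fun t => (hS t i).union (hS t (n+1))
  have hS0m : ∀ i, MeasurableSet (B i \ S0 i) := fun i => (hm i).diff (hS0 i).meas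
  let T : Set X := (fun p : Y × Y => π p.1) ''
    {p | p.1 ∈ B k \ S0 k ∧ p.2 ∈ B k \ S0 k ∧ p.1 ≠ p.2 ∧ π p.1 = π p.2}
  let Q : Set X := ⋂ i : ℕ, if i ≤ n ∧ i ≠ k then π '' (B i \ S0 i) else univ
  have hT : AnalyticSet T := by
    apply MeasurableSet.analyticSet_image
    · refine (measurable_fst (hS0m k)).inter ((measurable_snd (hS0m k)).inter
        (MeasurableSet.inter ?_ ?_))
      · exact (measurableSet_eq_fun measurable_fst measurable_snd).compl
      · exact measurableSet_eq_fun (hπ.measurable.comp measurable_fst)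
          (hπ.measurable.comp measurable_snd)
    · exact hπ.measurable.comp measurable_fst
  have hQ : AnalyticSet Q := by
    apply AnalyticSet.iInter
    intro i
    split_ifs
    · exact (hS0m i).analyticSet_image hπ.measurable
    · exact MeasurableSet.univ.analyticSet
  have hQT : Disjoint Q T := by
    rw [Set.disjoint_left]
    rintro _ hx ⟨⟨y, y'⟩, ⟨hy, hy', hne, hyy⟩, rfl⟩
    simp only at hy hy' hne hyy hx
    have hpos : 0 < dist y y' := dist_pos.2 hne
    obtain ⟨M0, hM0⟩ := exists_nat_one_div_lt (show 0 < dist y y' / 4 by positivity)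
    let M := max M0 N
    have hM : (1:ℝ) / (M+1) < dist y y' / 4 := by
      refine lt_of_le_of_lt ?_ hM0
      apply one_div_le_one_div_of_le (by positivity)
      have : M0 ≤ M := le_max_left _ _
      simpa using this
    have hMp : (0:ℝ) < 1 / (M+1) := by positivity
    obtain ⟨i, hi⟩ := (TopologicalSpace.denseRange_denseSeq Y).exists_dist_lt y hMp
    obtain ⟨j, hj⟩ := (TopologicalSpace.denseRange_denseSeq Y).exists_dist_lt y' hMp
    have hdis : Disjoint (cb i M) (cb j M) := by
      rw [Set.disjoint_left]
      intro z hz hz'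
      simp only [cb, Metric.mem_closedBall] at hz hz'
      have e1 := dist_triangle4 y (d i) z y'
      have e2 := dist_triangle z (d j) y'
      rw [dist_comm (d i) z] at e1
      rw [dist_comm (d j) y'] at e2
      have hi' : dist y (d i) < 1 / (M+1) := hi
      have hj' : dist y' (d j) < 1 / (M+1) := hj
      linarith
    let t : ι := ⟨(i, j, M), le_max_right _ _, hdis⟩
    apply hSx t (π y)
    intro l hl
    have hsub : ∀ l, S t l ⊆ S0 l := fun l z hz => mem_iUnion.2 ⟨t, Or.inl hz⟩
    have hsub' : S t (n+1) ⊆ S0 k := fun z hz => mem_iUnion.2 ⟨t, Or.inr hz⟩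
    by_cases h1 : l = n+1
    · subst h1
      refine ⟨y', ⟨?_, fun h => hy'.2 (hsub' h)⟩, hyy.symm⟩
      simp only [if_true]
      exact ⟨hy'.1, le_of_lt hj⟩
    by_cases h2 : l = k
    · subst h2
      refine ⟨y, ⟨?_, fun h => hy.2 (hsub _ h)⟩, rfl⟩
      simp only [if_neg h1, if_true]
      exact ⟨hy.1, le_of_lt hi⟩
    · have := mem_iInter.1 hx l
      rw [if_pos ⟨by omega, h2⟩] at this
      obtain ⟨z, hz, hzx⟩ := this
      refine ⟨z, ⟨?_, fun h => hz.2 (hsub _ h)⟩, hzx⟩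
      simp only [if_neg h1, if_neg h2]
      exact hz.1
  obtain ⟨W, hQW, hTW, hWm⟩ := hQ.measurablySeparable hT hQT
  let G := (B k \ S0 k) ∩ π ⁻¹' W
  have hG : Sml π G := by
    refine Sml.inj ((hS0m k).inter (hπ.measurable hWm)) ?_
    intro a ha b hb hab
    by_contra hne
    exact Set.disjoint_left.1 hTW ⟨(a, b), ⟨ha.1, hb.1, hne, hab⟩, rfl⟩ ha.2
  apply hB
  refine ⟨fun i => if i = k then S0 k ∪ G else S0 i, ?_, ?_⟩
  · intro i
    dsimp only
    split_ifs
    · exact (hS0 k).union hG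
    · exact hS0 i
  · intro x hx
    have hxQ : x ∈ Q := by
      refine mem_iInter.2 fun i => ?_
      split_ifs with h
      · obtain ⟨y, hy, hyx⟩ := hx i h.1
        simp only [if_neg h.2] at hy
        exact ⟨y, hy, hyx⟩
      · trivial
    obtain ⟨y, hy, hyx⟩ := hx k hk
    simp only [if_true] at hy
    apply hy.2
    by_cases h : y ∈ S0 k
    · exact Or.inl h
    · exact Or.inr ⟨⟨hy.1, h⟩, by rw [mem_preimage, hyx]; exact hQW hxQ⟩

theorem LN_top {π : Y → X} (hπ : Continuous π) (hc : ∀ x, (π ⁻¹' {x}).Countable) :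
    Sml π univ := by
  by_contra hns
  let τ : ℕ → ℕ := fun n => (Nat.unpair n).1
  have hτ : ∀ n, τ n ≤ n := Nat.unpair_left_le
  let St : ℕ → Type _ := fun n => {B : ℕ → Set Y // ¬ Bad π n B ∧ ∀ i, MeasurableSet (B i)}
  have step : ∀ n (B : St n), ∃ B' : St (n+1), ∃ U V : Set Y, IsClosed U ∧ IsClosed V ∧
      Disjoint U V ∧ (∀ u ∈ U, ∀ u' ∈ U, dist u u' ≤ 2 / ((n:ℝ) + 1)) ∧
      B'.1 (n+1) ⊆ B.1 (τ n) ∩ V ∧ B'.1 (τ n) ⊆ U ∧ ∀ i ≤ n, B'.1 i ⊆ B.1 i := by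
    intro n B
    obtain ⟨U, V, hU, hV, hUV, hd, hb⟩ := bad_step hπ B.2.1 B.2.2 (hτ n) n
    refine ⟨⟨_, hb, ?_⟩, U, V, hU, hV, hUV, hd, ?_, ?_, ?_⟩
    · intro i
      split_ifs
      · exact (B.2.2 _).inter hV.measurableSet
      · exact (B.2.2 _).inter hU.measurableSet
      · exact B.2.2 i
    · simp
    · have : τ n ≠ n + 1 := by have := hτ n; omega
      simp [this]
    · intro i hi
      have : i ≠ n+1 := by omega
      simp only [if_neg this]
      split_ifs with h
      · subst h; exact inter_subset_left
      · exact subset_rfl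
  choose next U V hU hV hUV hd hn1 hnk hni using step
  have h0 : ¬ Bad π 0 (fun _ => (univ : Set Y)) := by
    rintro ⟨S, hS, hx⟩
    apply hns
    have : S 0 = univ := by
      by_contra hne
      obtain ⟨y, hy⟩ := (ne_univ_iff_exists_notMem _).1 hne
      exact hx (π y) fun i hi => ⟨y, by simpa [Nat.le_zero.1 hi] using hy, rfl⟩
    rw [← this]; exact hS 0
  let s : (n : ℕ) → St n := fun n => Nat.rec ⟨_, h0, fun _ => MeasurableSet.univ⟩ next n
  have hs : ∀ n, s (n+1) = next n (s n) := fun n => rfl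
  have hmono : ∀ i n m, i ≤ n → n ≤ m → (s m).1 i ⊆ (s n).1 i := by
    intro i n m hin hnm
    induction m, hnm using Nat.le_induction with
    | base => exact subset_rfl
    | succ m hm ih => rw [hs]; exact (hni m (s m) i (by omega)).trans ih
  have hpt : ∀ n, ∃ x, ∀ i, ∃ y, i ≤ n → y ∈ (s n).1 i ∧ π y = x := by
    intro n
    have := (s n).2.1
    by_contra hcon
    push Not at hcon
    apply this
    refine ⟨fun _ => ∅, fun i => Sml.inj MeasurableSet.empty (injOn_empty _), fun x hx => ?_⟩
    obtain ⟨i, hi⟩ := hcon x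
    have hY : Nonempty Y := by obtain ⟨y, _⟩ := hx 0 (Nat.zero_le _); exact ⟨y⟩
    obtain ⟨y, hy, hyx⟩ := hx i (hi hY.some).1
    exact (hi y).2 hy.1 hyx
  choose x y hy using hpt
  -- for each i and M there is a split of i at a stage ≥ M
  have hsplit : ∀ i M : ℕ, ∃ n, M ≤ n ∧ i ≤ n ∧ τ n = i := fun i M =>
    ⟨Nat.pair i M, Nat.right_le_pair _ _, Nat.left_le_pair _ _, by simp [τ]⟩
  have hyU : ∀ n m, n < m → y m (τ n) ∈ U n (s n) := by
    intro n m hnm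
    have h1 := (hy m (τ n) ((hτ n).trans hnm.le)).1
    have h2 := hmono (τ n) (n+1) m ((hτ n).trans (Nat.le_succ _)) hnm h1
    rw [hs] at h2
    exact hnk n (s n) h2
  have hcau : ∀ i, CauchySeq (fun n => y n i) := by
    intro i
    rw [Metric.cauchySeq_iff']
    intro ε hε
    obtain ⟨M, hM⟩ := exists_nat_one_div_lt (show 0 < ε / 2 by positivity)
    obtain ⟨n, hMn, hin, hτn⟩ := hsplit i M
    refine ⟨n+1, fun m hm => ?_⟩
    have h1 := hyU n m hm
    have h2 := hyU n (n+1) (Nat.lt_succ_self _)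
    rw [hτn] at h1 h2
    refine lt_of_le_of_lt (hd n (s n) _ h1 _ h2) ?_
    have h3 : (1:ℝ) / (n+1) ≤ 1 / (M+1) := by
      apply one_div_le_one_div_of_le (by positivity)
      simpa using hMn
    have h4 : (2:ℝ) / (n+1) = 2 * (1/(n+1)) := by ring
    linarith
  choose c hcl using fun i => cauchySeq_tendsto_of_complete (hcau i)
  have hcπ : ∀ i, π (c i) = π (c 0) := by
    intro i
    have h1 : Tendsto (fun n => π (y n i)) atTop (𝓝 (π (c i))) := (hπ.tendsto _).comp (hcl i)
    have h2 : Tendsto (fun n => π (y n 0)) atTop (𝓝 (π (c 0))) := (hπ.tendsto _).comp (hcl 0)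
    refine tendsto_nhds_unique (h1.congr' ?_) h2
    filter_upwards [eventually_ge_atTop i] with n hn
    rw [(hy n i hn).2, (hy n 0 (Nat.zero_le _)).2]
  have hcU : ∀ n, c (τ n) ∈ U n (s n) := by
    intro n
    refine (hU n (s n)).mem_of_tendsto (hcl (τ n)) ?_
    filter_upwards [eventually_gt_atTop n] with m hm using hyU n m hm
  have hcV : ∀ n, c (n+1) ∈ V n (s n) := by
    intro n
    refine (hV n (s n)).mem_of_tendsto (hcl (n+1)) ?_
    filter_upwards [eventually_ge_atTop (n+1)] with m hm
    have h2 := hmono (n+1) (n+1) m le_rfl hm (hy m (n+1) hm).1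
    rw [hs] at h2
    exact (hn1 n (s n) h2).2
  have hcU' : ∀ n n', n < n' → τ n' = τ n → c (n'+1) ∈ U n (s n) := by
    intro n n' hnn hτe
    refine (hU n (s n)).mem_of_tendsto (hcl (n'+1)) ?_
    filter_upwards [eventually_ge_atTop (n'+1)] with m hm
    have h2 := hmono (n'+1) (n'+1) m le_rfl hm (hy m (n'+1) hm).1
    rw [hs] at h2
    have h3 := (hn1 n' (s n') h2).1
    have h4 := hmono (τ n') (n+1) n' (by rw [hτe]; exact (hτ n).trans (Nat.le_succ _)) hnn h3
    rw [hs, hτe] at h4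
    exact hnk n (s n) h4
  have hpre : Preperfect (range c) := by
    rw [preperfect_iff_nhds]
    rintro _ ⟨i, rfl⟩ O hO
    obtain ⟨ε, hε, hball⟩ := Metric.mem_nhds_iff.1 hO
    obtain ⟨M, hM⟩ := exists_nat_one_div_lt (show 0 < ε / 2 by positivity)
    obtain ⟨n, hMn, hin, hτn⟩ := hsplit i M
    obtain ⟨n', hMn', hin', hτn'⟩ := hsplit i (n+1)
    refine ⟨c (n'+1), ⟨hball ?_, mem_range_self _⟩, ?_⟩
    · have h1 := hcU' n n' hMn' (hτn'.trans hτn.symm)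
      have h2 := hcU n
      rw [hτn] at h2
      rw [Metric.mem_ball]
      refine lt_of_le_of_lt (hd n (s n) _ h1 _ h2) ?_
      have h3 : (1:ℝ) / (n+1) ≤ 1 / (M+1) := by
        apply one_div_le_one_div_of_le (by positivity)
        simpa using hMn
      have h4 : (2:ℝ) / (n+1) = 2 * (1/(n+1)) := by ring
      linarith
    · intro he
      have h1 := hcV n'
      have h2 := hcU n'
      rw [hτn'] at h2
      rw [he] at h1
      exact Set.disjoint_left.1 (hUV n' (s n')) h2 h1
  obtain ⟨f, hf, -, hfi⟩ := hpre.perfect_closure.exists_nat_bool_injection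
    ⟨c 0, subset_closure (mem_range_self _)⟩
  have hsub : closure (range c) ⊆ π ⁻¹' {π (c 0)} := by
    apply closure_minimal
    · rintro _ ⟨i, rfl⟩; exact hcπ i
    · exact (isClosed_singleton).preimage hπ
  have hcount : (range f).Countable := (hc (π (c 0))).mono (hf.trans hsub)
  have : Countable (ℕ → Bool) := by
    have := hcount.to_subtype
    exact (Equiv.ofInjective f hfi).injective.countable
  have h1 := Cardinal.mk_le_aleph0_iff.2 this
  rw [← Cardinal.power_def, Cardinal.mk_bool, Cardinal.mk_nat] at h1
  exact absurd h1 (not_le.2 (Cardinal.cantor _))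
end

theorem LN {Y X : Type*} [mY : MeasurableSpace Y] [StandardBorelSpace Y]
    [MeasurableSpace X] [StandardBorelSpace X] {π : Y → X} (hπ : Measurable π)
    (hc : ∀ x, (π ⁻¹' {x}).Countable) :
    ∃ G : ℕ → Set Y, (∀ n, MeasurableSet (G n)) ∧ (∀ n, InjOn π (G n)) ∧ ⋃ n, G n = univ := by
  have main : Sml π univ := by
    let := upgradeStandardBorel X
    obtain ⟨tY, hbY, hpY⟩ := StandardBorelSpace.polish (α := Y)
    obtain ⟨t', ht', hcont, hpol⟩ := hπ.exists_continuous
    have hb : @BorelSpace Y t' mY := by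
      refine @BorelSpace.mk _ t' _ ?_
      rw [hbY.measurable_eq]
      exact (borel_eq_borel_of_le hpol hpY ht').symm
    let := t'
    let := TopologicalSpace.upgradeIsCompletelyMetrizable Y
    exact LN_top hcont hc
  obtain ⟨𝒢, h𝒢, hG, hU⟩ := main
  have hne : (insert ∅ 𝒢).Nonempty := ⟨∅, by simp⟩
  obtain ⟨g, hg⟩ := (h𝒢.insert ∅).exists_eq_range hne
  have hg' : ∀ n, MeasurableSet (g n) ∧ InjOn π (g n) := by
    intro n
    have : g n ∈ insert ∅ 𝒢 := hg ▸ mem_range_self n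
    rcases this with h | h
    · rw [h]; exact ⟨MeasurableSet.empty, injOn_empty _⟩
    · exact hG _ h
  refine ⟨g, fun n => (hg' n).1, fun n => (hg' n).2, ?_⟩
  rw [← sUnion_range, ← hg, sUnion_insert, empty_union, hU]

end EVB

namespace EVB

theorem inv_ext {Y Z : Type*} [MeasurableSpace Y] [StandardBorelSpace Y] [Nonempty Y]
    [MeasurableSpace Z] [StandardBorelSpace Z] {f : Y → Z} (hf : Measurable f) {D : Set Y}
    (hD : MeasurableSet D) (hi : InjOn f D) :
    ∃ g : Z → Y, Measurable g ∧ ∀ y ∈ D, g (f y) = y := by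
  have := hD.standardBorel
  have he : MeasurableEmbedding (fun y : D => f y) :=
    (hf.comp measurable_subtype_coe).measurableEmbedding
      (fun a b h => Subtype.ext (hi a.2 b.2 h))
  obtain ⟨g, hg, hgf⟩ := he.exists_measurable_extend measurable_subtype_coe (fun _ => ‹Nonempty Y›)
  exact ⟨g, hg, fun y hy => congrFun hgf ⟨y, hy⟩⟩

section
variable {X : Type*} [MeasurableSpace X]

def PI (F : Set (X × X)) (D : Set X) (f : X → X) : Prop :=
  MeasurableSet D ∧ Measurable f ∧ InjOn f D ∧ ∀ x ∈ D, (x, f x) ∈ F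

variable {F : Set (X × X)}

theorem PI.mono {D D' : Set X} {f : X → X} (h : PI F D f) (hD' : MeasurableSet D')
    (hs : D' ⊆ D) : PI F D' f :=
  ⟨hD', h.2.1, h.2.2.1.mono hs, fun x hx => h.2.2.2 x (hs hx)⟩

variable [StandardBorelSpace X]

theorem PI.image {D : Set X} {f : X → X} (h : PI F D f) : MeasurableSet (f '' D) :=
  h.1.image_of_measurable_injOn h.2.1 h.2.2.1

theorem PI.inv [Nonempty X] (hF : IsCBER F) {D : Set X} {f : X → X} (h : PI F D f) :
    ∃ g, PI F (f '' D) g ∧ ∀ x ∈ D, g (f x) = x := by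
  obtain ⟨g, hg, hgf⟩ := inv_ext h.2.1 h.1 h.2.2.1
  refine ⟨g, ⟨h.image, hg, ?_, ?_⟩, hgf⟩
  · rintro _ ⟨a, ha, rfl⟩ _ ⟨b, hb, rfl⟩ hab
    rw [hgf a ha, hgf b hb] at hab
    rw [hab]
  · rintro _ ⟨a, ha, rfl⟩
    rw [hgf a ha]
    exact hF.2.1.symm (h.2.2.2 a ha)

theorem PI.comp (hF : IsCBER F) {D A : Set X} {f g : X → X} (h : PI F D f) (hg : PI F A g) :
    PI F (D ∩ f ⁻¹' A) (g ∘ f) := by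
  refine ⟨h.1.inter (h.2.1 hg.1), hg.2.1.comp h.2.1, ?_, ?_⟩
  · intro a ha b hb hab
    exact h.2.2.1 ha.1 hb.1 (hg.2.2.1 ha.2 hb.2 hab)
  · intro a ha
    exact hF.2.1.trans (h.2.2.2 a ha.1) (hg.2.2.2 _ ha.2)

theorem exists_family [Nonempty X] (hF : IsCBER F) :
    ∃ (D : ℕ → Set X) (f : ℕ → X → X), (∀ n, PI F (D n) (f n)) ∧
      ∀ p ∈ F, ∃ n, p.1 ∈ D n ∧ f n p.1 = p.2 := by
  have := hF.1.standardBorel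
  have hc1 : ∀ x, ((fun p : F => p.1.1) ⁻¹' {x}).Countable := by
    intro x
    refine MapsTo.countable_of_injOn (f := fun p : F => p.1.2) (t := {y | (x, y) ∈ F}) ?_ ?_ (hF.2.2 x)
    · rintro ⟨⟨a, b⟩, hp⟩ h
      simp only [mem_preimage, mem_singleton_iff] at h
      subst h; exact hp
    · rintro ⟨⟨a, b⟩, hp⟩ h ⟨⟨a', b'⟩, hp'⟩ h' hh
      simp only [mem_preimage, mem_singleton_iff] at h h' hh
      subst h; subst h'; subst hh; rfl
  have hc2 : ∀ x, ((fun p : F => p.1.2) ⁻¹' {x}).Countable := by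
    intro x
    refine MapsTo.countable_of_injOn (f := fun p : F => p.1.1) (t := {y | (x, y) ∈ F}) ?_ ?_ (hF.2.2 x)
    · rintro ⟨⟨a, b⟩, hp⟩ h
      simp only [mem_preimage, mem_singleton_iff] at h
      subst h; exact hF.2.1.symm hp
    · rintro ⟨⟨a, b⟩, hp⟩ h ⟨⟨a', b'⟩, hp'⟩ h' hh
      simp only [mem_preimage, mem_singleton_iff] at h h' hh
      subst h; subst h'; subst hh; rfl
  obtain ⟨G, hGm, hGi, hGU⟩ := LN (measurable_fst.comp measurable_subtype_coe) hc1
  obtain ⟨G', hGm', hGi', hGU'⟩ := LN (measurable_snd.comp measurable_subtype_coe) hc2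
  let H : ℕ → Set (X × X) := fun n => Subtype.val '' (G n.unpair.1 ∩ G' n.unpair.2)
  have hH : ∀ n, MeasurableSet (H n) := fun n =>
    (MeasurableEmbedding.subtype_coe hF.1).measurableSet_image.2 ((hGm _).inter (hGm' _))
  have hH1 : ∀ n, InjOn Prod.fst (H n) := by
    rintro n _ ⟨a, ha, rfl⟩ _ ⟨b, hb, rfl⟩ hab
    rw [hGi _ ha.1 hb.1 hab]
  have hH2 : ∀ n, InjOn Prod.snd (H n) := by
    rintro n _ ⟨a, ha, rfl⟩ _ ⟨b, hb, rfl⟩ hab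
    rw [hGi' _ ha.2 hb.2 hab]
  choose g hg hgf using fun n => inv_ext measurable_fst (hH n) (hH1 n)
  refine ⟨fun n => Prod.fst '' H n, fun n => Prod.snd ∘ g n, ?_, ?_⟩
  · intro n
    refine ⟨(hH n).image_of_measurable_injOn measurable_fst (hH1 n), measurable_snd.comp (hg n), ?_, ?_⟩
    · rintro _ ⟨a, ha, rfl⟩ _ ⟨b, hb, rfl⟩ hab
      simp only [Function.comp, hgf n a ha, hgf n b hb] at hab
      rw [hH2 n ha hb hab]
    · rintro _ ⟨a, ha, rfl⟩
      simp only [Function.comp, hgf n a ha]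
      obtain ⟨q, _, rfl⟩ := ha
      exact q.2
  · intro p hp
    have h1 : (⟨p, hp⟩ : F) ∈ ⋃ n, G n := hGU ▸ mem_univ _
    have h2 : (⟨p, hp⟩ : F) ∈ ⋃ n, G' n := hGU' ▸ mem_univ _
    obtain ⟨i, hi⟩ := mem_iUnion.1 h1
    obtain ⟨j, hj⟩ := mem_iUnion.1 h2
    have hpH : p ∈ H (Nat.pair i j) := ⟨⟨p, hp⟩, by simp [hi, hj], rfl⟩
    exact ⟨Nat.pair i j, ⟨p, hpH, rfl⟩, by simp [hgf _ p hpH]⟩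

noncomputable def msup (μ : Measure X) (F : Set (X × X)) (R : Set X) : Measure X :=
  ⨆ p : {p : Set X × (X → X) // PI F p.1 p.2 ∧ p.1 ⊆ R}, (μ.restrict p.1.1).map p.1.2

theorem le_msup {μ : Measure X} {R D : Set X} {f : X → X} (h : PI F D f) (hD : D ⊆ R) {C : Set X}
    (hC : MeasurableSet C) : μ (f ⁻¹' C ∩ D) ≤ msup μ F R C := by
  have h1 : (μ.restrict D).map f ≤ msup μ F R :=
    le_iSup (fun p : {p : Set X × (X → X) // PI F p.1 p.2 ∧ p.1 ⊆ R} =>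
      (μ.restrict p.1.1).map p.1.2) ⟨(D, f), h, hD⟩
  have := h1 C
  rwa [Measure.map_apply h.2.1 hC, Measure.restrict_apply (h.2.1 hC)] at this

theorem msup_le {μ : Measure X} {R : Set X} {N : Measure X}
    (h : ∀ D f, PI F D f → D ⊆ R → ∀ C, MeasurableSet C → μ (f ⁻¹' C ∩ D) ≤ N C) :
    msup μ F R ≤ N := by
  refine iSup_le ?_
  rintro ⟨⟨D, f⟩, hp, hD⟩
  refine Measure.le_iff.2 fun C hC => ?_
  have hp' : PI F D f := hp
  show (μ.restrict D).map f C ≤ N C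
  rw [Measure.map_apply hp'.2.1 hC, Measure.restrict_apply (hp'.2.1 hC)]
  exact h D f hp hD C hC

theorem msup_image_le [Nonempty X] (hF : IsCBER F) {μ : Measure X} {R A B : Set X} {g : X → X}
    (hg : PI F A g) (hB : MeasurableSet B) (hBA : B ⊆ A) :
    msup μ F R B ≤ msup μ F R (g '' B) := by
  obtain ⟨g', hg', hgg⟩ := hg.inv hF
  set m := msup μ F R with hm
  have hmN : m ≤ (m.restrict (g '' A)).map g' + m.restrict Aᶜ := by
    refine msup_le fun D f hf hD C hC => ?_
    have hCA : MeasurableSet (C ∩ A) := hC.inter hg.1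
    have himg : MeasurableSet (g '' (C ∩ A)) := (hg.mono hCA inter_subset_right).image
    have e1 : μ (f ⁻¹' (C ∩ A) ∩ D) ≤ m (g' ⁻¹' C ∩ g '' A) := by
      refine le_trans (le_trans (measure_mono ?_) (le_msup (hf.comp hF hg) (inter_subset_left.trans hD) himg))
        (measure_mono ?_)
      · rintro x ⟨hx, hxD⟩
        exact ⟨⟨f x, hx, rfl⟩, hxD, hx.2⟩
      · rintro _ ⟨a, ha, rfl⟩
        exact ⟨by rw [mem_preimage, hgg a ha.2]; exact ha.1, a, ha.2, rfl⟩
    have e2 : μ (f ⁻¹' (C ∩ Aᶜ) ∩ D) ≤ m (C ∩ Aᶜ) := le_msup hf hD (hC.inter hg.1.compl)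
    rw [Measure.add_apply, Measure.map_apply hg'.2.1 hC, Measure.restrict_apply (hg'.2.1 hC),
      Measure.restrict_apply hC]
    refine le_trans ?_ (add_le_add e1 e2)
    refine le_trans (measure_mono ?_) (measure_union_le _ _)
    rintro x ⟨hx, hxD⟩
    by_cases h : f x ∈ A
    · exact Or.inl ⟨⟨hx, h⟩, hxD⟩
    · exact Or.inr ⟨⟨hx, h⟩, hxD⟩
  refine (hmN B).trans ?_
  rw [Measure.add_apply, Measure.map_apply hg'.2.1 hB, Measure.restrict_apply (hg'.2.1 hB),
      Measure.restrict_apply hB]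
  have : B ∩ Aᶜ = ∅ := by
    rw [← sdiff_eq]; exact sdiff_eq_empty.2 hBA
  rw [this, measure_empty, add_zero]
  refine measure_mono ?_
  rintro _ ⟨hz, a, ha, rfl⟩
  rw [mem_preimage, hgg a ha] at hz
  exact ⟨a, hz, rfl⟩

theorem msup_image [Nonempty X] (hF : IsCBER F) {μ : Measure X} {R B : Set X} {g : X → X}
    (hg : PI F B g) : msup μ F R (g '' B) = msup μ F R B := by
  refine le_antisymm ?_ (msup_image_le hF hg hg.1 subset_rfl)
  obtain ⟨g', hg', hgg⟩ := hg.inv hF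
  have := msup_image_le (μ := μ) (R := R) hF hg' hg.image subset_rfl
  rwa [image_image, image_congr (fun x hx => hgg x hx), image_id'] at this

def NS (μ : Measure X) (F : Set (X × X)) : Prop :=
  ∀ D f, PI F D f → (μ D = 0 ↔ μ (f '' D) = 0)

theorem keyK [Nonempty X] (hF : IsCBER F) {μ : Measure X} [IsFiniteMeasure μ] (hns : NS μ F)
    (herg : ErgodicRel μ F) (hIII : IsTypeIII μ F)
    {D : ℕ → Set X} {f : ℕ → X → X} (hf : ∀ n, PI F (D n) (f n))
    (hcov : ∀ p ∈ F, ∃ n, p.1 ∈ D n ∧ f n p.1 = p.2)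
    {R R' : Set X} (hR : MeasurableSet R) (hR' : MeasurableSet R') (hR0 : μ R ≠ 0) (hR0' : μ R' ≠ 0)
    {c : ℝ≥0∞} (hc0 : c ≠ 0) (hc1 : c ≠ ∞)
    (H : ∀ n, ∀ B, MeasurableSet B → B ⊆ R ∩ D n ∩ f n ⁻¹' R' → c * μ B ≤ μ (f n '' B)) : False := by
  have hgen : ∀ B g, PI F B g → B ⊆ R → g '' B ⊆ R' → c * μ B ≤ μ (g '' B) := by
    intro B g hg hBR hgR
    let P : ℕ → Set X := fun n => B ∩ D n ∩ {x | g x = f n x}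
    have hP : ∀ n, MeasurableSet (P n) := fun n =>
      (hg.1.inter (hf n).1).inter (measurableSet_eq_fun hg.2.1 (hf n).2.1)
    have hQ : ∀ n, MeasurableSet (disjointed P n) := fun n => MeasurableSet.disjointed hP n
    have hQP : ∀ n, disjointed P n ⊆ P n := disjointed_subset P
    have hU : ⋃ n, disjointed P n = B := by
      rw [iUnion_disjointed]
      refine Subset.antisymm (iUnion_subset fun n x hx => hx.1.1) fun x hx => ?_
      obtain ⟨n, hn, hn'⟩ := hcov _ (hg.2.2.2 x hx)
      exact mem_iUnion.2 ⟨n, ⟨hx, hn⟩, hn'.symm⟩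
    have hQB : ∀ n, disjointed P n ⊆ B := fun n x hx => (hQP n hx).1.1
    have hdis : Pairwise (Function.onFun Disjoint (fun n => g '' disjointed P n)) := by
      intro i j hij
      refine Set.disjoint_left.2 ?_
      rintro _ ⟨a, ha, rfl⟩ ⟨b, hb, hab⟩
      have := hg.2.2.1 (hQB j hb) (hQB i ha) hab
      subst this
      exact Set.disjoint_left.1 (disjoint_disjointed P hij) ha hb
    rw [← hU, measure_iUnion (disjoint_disjointed P) hQ, image_iUnion,
      measure_iUnion hdis (fun n => (hg.mono (hQ n) (hQB n)).image), ← ENNReal.tsum_mul_left]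
    refine ENNReal.tsum_le_tsum fun n => ?_
    have : g '' disjointed P n = f n '' disjointed P n := image_congr fun x hx => (hQP n hx).2
    rw [this]
    refine H n _ (hQ n) fun x hx => ⟨⟨hBR (hQB n hx), (hQP n hx).1.2⟩, ?_⟩
    rw [mem_preimage, ← (hQP n hx).2]
    exact hgR ⟨x, hQB n hx, rfl⟩
  set m := msup μ F R with hm
  have hM : m ≤ c⁻¹ • μ.restrict R' + (∞ : ℝ≥0∞) • μ.restrict R'ᶜ := by
    refine msup_le fun B g hg hBR C hC => ?_
    rw [Measure.add_apply, Measure.smul_apply, Measure.smul_apply, Measure.restrict_apply hC,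
      Measure.restrict_apply hC, smul_eq_mul, smul_eq_mul]
    have e1 : μ (g ⁻¹' (C ∩ R') ∩ B) ≤ c⁻¹ * μ (C ∩ R') := by
      rw [← ENNReal.mul_le_iff_le_inv hc0 hc1]
      have hs : g '' (g ⁻¹' (C ∩ R') ∩ B) ⊆ C ∩ R' := by
        rintro _ ⟨x, hx, rfl⟩; exact hx.1
      refine le_trans (hgen _ g (hg.mono ((hg.2.1 (hC.inter hR')).inter hg.1) inter_subset_right)
        (inter_subset_right.trans hBR) (hs.trans inter_subset_right)) (measure_mono hs)
    have e2 : μ (g ⁻¹' (C ∩ R'ᶜ) ∩ B) ≤ ∞ * μ (C ∩ R'ᶜ) := by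
      by_cases h0 : μ (C ∩ R'ᶜ) = 0
      · have hs : g '' (g ⁻¹' (C ∩ R'ᶜ) ∩ B) ⊆ C ∩ R'ᶜ := by
          rintro _ ⟨x, hx, rfl⟩; exact hx.1
        have := (hns _ g (hg.mono ((hg.2.1 (hC.inter hR'.compl)).inter hg.1)
          inter_subset_right)).2 (measure_mono_null hs h0)
        rw [this]; exact zero_le
      · rw [ENNReal.top_mul h0]; exact le_top
    refine le_trans ?_ (add_le_add e1 e2)
    refine le_trans (measure_mono ?_) (measure_union_le _ _)
    rintro x ⟨hx, hxD⟩
    by_cases h : g x ∈ R'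
    · exact Or.inl ⟨⟨hx, h⟩, hxD⟩
    · exact Or.inr ⟨⟨hx, h⟩, hxD⟩
  have hac : m ≪ μ := by
    refine Measure.AbsolutelyContinuous.mk fun C hC h0 => ?_
    refine le_antisymm ((hM C).trans ?_) zero_le
    rw [Measure.add_apply, Measure.smul_apply, Measure.smul_apply, Measure.restrict_apply hC,
      Measure.restrict_apply hC, measure_mono_null inter_subset_left h0,
      measure_mono_null inter_subset_left h0]
    simp
  have hRm : ∀ C, MeasurableSet C → C ⊆ R → μ C ≤ m C := by
    intro C hC hCR
    have := le_msup (μ := μ) (F := F) (R := R) (D := C) (f := id)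
      ⟨hC, measurable_id, injOn_id _, fun x _ => hF.2.1.refl x⟩ hCR hC
    simpa using this
  have hTm : ∀ (S : Set X), MeasurableSet S → ∀ n, MeasurableSet (D n ∩ f n ⁻¹' S) :=
    fun S hS n => (hf n).1.inter ((hf n).2.1 hS)
  have hsat : ∀ S : Set X, ESat F S = ⋃ n, D n ∩ f n ⁻¹' S := by
    intro S
    ext x
    simp only [ESat, mem_ofPred_eq, mem_iUnion]
    constructor
    · rintro ⟨y, hy, hxy⟩
      obtain ⟨n, hn, hn'⟩ := hcov _ hxy
      exact ⟨n, hn, by rw [mem_preimage, hn']; exact hy⟩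
    · rintro ⟨n, hn, hn'⟩
      exact ⟨f n x, hn', (hf n).2.2.2 x hn⟩
  have hac' : μ ≪ m := by
    refine Measure.AbsolutelyContinuous.mk fun C hC h0 => ?_
    have h1 : C ⊆ (ESat F R)ᶜ ∪ ⋃ n, C ∩ (D n ∩ f n ⁻¹' R) := by
      intro x hx
      by_cases h : x ∈ ESat F R
      · rw [hsat] at h
        rw [← inter_iUnion]
        exact Or.inr ⟨hx, h⟩
      · exact Or.inl h
    refine measure_mono_null h1 (measure_union_null (herg R hR hR0) (measure_iUnion_null fun n => ?_))
    have hp := (hf n).mono (hC.inter (hTm R hR n)) (fun x hx => hx.2.1)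
    rw [hns _ _ hp]
    refine le_antisymm ((hRm _ hp.image ?_).trans ?_) zero_le
    · rintro _ ⟨x, hx, rfl⟩; exact hx.2.2
    · rw [hm, msup_image hF hp]
      exact (measure_mono inter_subset_left).trans h0.le
  have hsf : SigmaFinite m := by
    refine Measure.sigmaFinite_of_countable
      (S := insert (ESat F R')ᶜ (range fun n => D n ∩ f n ⁻¹' R'))
      ((countable_range _).insert _) ?_ ?_
    · rintro s (rfl | ⟨n, rfl⟩)
      · rw [hac (herg R' hR' hR0')]; exact ENNReal.zero_lt_top
      · have hp := (hf n).mono (hTm R' hR' n) (fun x hx => hx.1)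
        show m (D n ∩ f n ⁻¹' R') < ∞
        rw [hm, ← msup_image hF hp, ← hm]
        have hs : f n '' (D n ∩ f n ⁻¹' R') ⊆ R' := by
          rintro _ ⟨x, hx, rfl⟩; exact hx.2
        refine lt_of_le_of_lt ((measure_mono hs).trans (hM R')) ?_
        rw [Measure.add_apply, Measure.smul_apply, Measure.smul_apply, Measure.restrict_apply hR',
          Measure.restrict_apply hR']
        simp only [inter_self, inter_compl_self, measure_empty, smul_zero, mul_zero, add_zero, smul_eq_mul]
        exact ENNReal.mul_lt_top (ENNReal.inv_lt_top.2 (pos_iff_ne_zero.2 hc0)) (measure_lt_top _ _)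
    · rw [sUnion_insert, sUnion_range, ← hsat, compl_union_self]
  refine hIII ⟨m, hsf, ⟨hac, hac'⟩, ?_⟩
  intro g A hg hA hgi hgF
  have hp : PI F A g := ⟨hA, hg, hgi, hgF⟩
  ext C hC
  rw [Measure.map_apply hg hC, Measure.restrict_apply (hg hC), Measure.restrict_apply hC,
    hm, ← msup_image hF (hp.mono ((hg hC).inter hA) inter_subset_right)]
  congr 1
  ext z
  constructor
  · rintro ⟨x, hx, rfl⟩; exact ⟨hx.1, x, hx.2, rfl⟩
  · rintro ⟨hz, x, hx, rfl⟩; exact ⟨x, ⟨hz, hx⟩, rfl⟩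

end
end EVB

namespace EVB

theorem greedy {Y X : Type*} [MeasurableSpace Y] [StandardBorelSpace Y]
    [MeasurableSpace X] [StandardBorelSpace X]
    {p : ℕ → Y → X} (hp : ∀ j, Measurable (p j)) {P : ℕ → Set Y} (hP : ∀ j, MeasurableSet (P j))
    (hi : ∀ j, InjOn (p j) (P j)) {A : Set X} (hA : MeasurableSet A) :
    ∃ Q : ℕ → Set Y, (∀ j, MeasurableSet (Q j)) ∧ (∀ j, Q j ⊆ P j) ∧
      (∀ j, MapsTo (p j) (Q j) A) ∧
      Pairwise (Function.onFun Disjoint Q) ∧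
      Pairwise (Function.onFun Disjoint (fun j => p j '' Q j)) ∧
      ∀ j, ∀ y ∈ P j, p j y ∈ A → y ∈ (⋃ i, Q i) ∨ p j y ∈ ⋃ i, p i '' Q i := by
  let step : ℕ → Set Y × Set X → Set Y := fun j s => ((P j ∩ p j ⁻¹' A) \ s.1) \ (p j ⁻¹' s.2)
  let st : ℕ → Set Y × Set X := fun j =>
    Nat.rec (∅, ∅) (fun j s => (s.1 ∪ step j s, s.2 ∪ p j '' step j s)) j
  let Q : ℕ → Set Y := fun j => step j (st j)
  have hs1 : ∀ j, (st (j+1)).1 = (st j).1 ∪ Q j := fun j => rfl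
  have hs2 : ∀ j, (st (j+1)).2 = (st j).2 ∪ p j '' Q j := fun j => rfl
  have hQP : ∀ j, Q j ⊆ P j := fun j y hy => hy.1.1.1
  have hQ' : ∀ j, MeasurableSet (st j).1 ∧ MeasurableSet (st j).2 → MeasurableSet (Q j) :=
    fun j h => (((hP j).inter (hp j hA)).diff h.1).diff (hp j h.2)
  have hst : ∀ j, MeasurableSet (st j).1 ∧ MeasurableSet (st j).2 := by
    intro j
    induction j with
    | zero => exact ⟨MeasurableSet.empty, MeasurableSet.empty⟩
    | succ j ih =>
      rw [hs1, hs2]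
      exact ⟨ih.1.union (hQ' j ih), ih.2.union
        ((hQ' j ih).image_of_measurable_injOn (hp j) ((hi j).mono (hQP j)))⟩
  have hlt : ∀ i j, i < j → Q i ⊆ (st j).1 ∧ p i '' Q i ⊆ (st j).2 := by
    intro i j hij
    induction j with
    | zero => omega
    | succ j ih =>
      rw [hs1, hs2]
      rcases Nat.lt_succ_iff_lt_or_eq.1 hij with h | rfl
      · exact ⟨(ih h).1.trans subset_union_left, (ih h).2.trans subset_union_left⟩
      · exact ⟨subset_union_right, subset_union_right⟩
  have hle : ∀ j, (st j).1 ⊆ ⋃ i, Q i ∧ (st j).2 ⊆ ⋃ i, p i '' Q i := by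
    intro j
    induction j with
    | zero => exact ⟨empty_subset _, empty_subset _⟩
    | succ j ih =>
      rw [hs1, hs2]
      exact ⟨union_subset ih.1 (subset_iUnion Q j),
        union_subset ih.2 (subset_iUnion (fun i => p i '' Q i) j)⟩
  refine ⟨Q, fun j => hQ' j (hst j), hQP, fun j y hy => hy.1.1.2, ?_, ?_, ?_⟩
  · refine (pairwise_disjoint_on Q).2 fun i j hij => ?_
    exact Set.disjoint_left.2 fun y hy hy' => hy'.1.2 ((hlt i j hij).1 hy)
  · refine (pairwise_disjoint_on _).2 fun i j hij => ?_
    refine Set.disjoint_left.2 fun x hx hx' => ?_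
    obtain ⟨y, hy, rfl⟩ := hx'
    exact hy.2 ((hlt i j hij).2 hx)
  · intro j y hy hyA
    by_cases h1 : y ∈ (st j).1
    · exact Or.inl ((hle j).1 h1)
    by_cases h2 : p j y ∈ (st j).2
    · exact Or.inr ((hle j).2 h2)
    · exact Or.inl (mem_iUnion.2 ⟨j, ⟨⟨hy, hyA⟩, h1⟩, h2⟩)

theorem ratio {X : Type*} [MeasurableSpace X] [StandardBorelSpace X] [Nonempty X]
    {F : Set (X × X)} (hF : IsCBER F) (μ : Measure X) [IsFiniteMeasure μ] {D : Set X} {f : X → X}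
    (h : PI F D f) {c : ℝ≥0∞} (hc : c ≠ ∞) :
    ∃ H, MeasurableSet H ∧ (∀ B, MeasurableSet B → B ⊆ D ∩ H → μ (f '' B) ≤ c * μ B) ∧
      ∀ B, MeasurableSet B → B ⊆ D ∩ Hᶜ → c * μ B ≤ μ (f '' B) := by
  obtain ⟨g, hg, hgf⟩ := h.inv hF
  have hν : ∀ B, MeasurableSet B → B ⊆ D → (μ.restrict (f '' D)).map g B = μ (f '' B) := by
    intro B hB hBD
    rw [Measure.map_apply hg.2.1 hB, Measure.restrict_apply (hg.2.1 hB)]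
    congr 1
    ext z
    constructor
    · rintro ⟨hz, x, hx, rfl⟩
      rw [mem_preimage, hgf x hx] at hz
      exact ⟨x, hz, rfl⟩
    · rintro ⟨x, hx, rfl⟩
      exact ⟨by rw [mem_preimage, hgf x (hBD hx)]; exact hx, x, hBD hx, rfl⟩
  have : IsFiniteMeasure (c • μ) := μ.smul_finite hc
  obtain ⟨H, hH, h1, h2⟩ := hahn_decomposition (c • μ) ((μ.restrict (f '' D)).map g)
  refine ⟨H, hH, fun B hB hBD => ?_, fun B hB hBD => ?_⟩
  · rw [← hν B hB fun x hx => (hBD hx).1]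
    simpa using h1 B hB fun x hx => (hBD hx).2
  · rw [← hν B hB fun x hx => (hBD hx).1]
    simpa using h2 B hB fun x hx => (hBD hx).2

theorem emb {Y X : Type*} [MeasurableSpace Y] [StandardBorelSpace Y]
    [MeasurableSpace X] [StandardBorelSpace X] [Nonempty X]
    {F : Set (X × X)} (hF : IsCBER F) {μ : Measure X} [IsFiniteMeasure μ] (hns : NS μ F)
    (herg : ErgodicRel μ F) (hIII : IsTypeIII μ F)
    {s : Y → X} (hs : Measurable s) {𝒜 : ℕ → Set Y} (h𝒜 : ∀ m, MeasurableSet (𝒜 m))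
    (hsi : ∀ m, InjOn s (𝒜 m)) {A : Set X} (hA : MeasurableSet A) (hA0 : μ A ≠ 0) :
    ∃ (φ : Y → X) (D₀ : Set Y), Measurable φ ∧ MeasurableSet D₀ ∧ D₀ ⊆ ⋃ m, 𝒜 m ∧ InjOn φ D₀ ∧
      MapsTo φ D₀ A ∧ (∀ y ∈ D₀, (φ y, s y) ∈ F) ∧ ∀ m, μ (s '' (𝒜 m \ D₀)) = 0 := by
  obtain ⟨D, f, hf, hcov⟩ := exists_family hF
  have hu : μ univ ≠ ∞ := measure_ne_top _ _
  obtain ⟨c, hc0, hcs⟩ := ENNReal.exists_pos_sum_of_countable' (ε := μ A / μ univ)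
    (ENNReal.div_pos hA0 hu).ne' ℕ
  have hc1 : ∀ m, c m ≠ ∞ := fun m => ((ENNReal.le_tsum m).trans_lt (hcs.trans_le le_top)).ne
  choose H hH hH1 hH2 using fun n m => ratio hF μ (hf n) (hc1 m)
  let P : ℕ → Set Y := fun j => 𝒜 j.unpair.2 ∩ s ⁻¹' (D j.unpair.1 ∩ H j.unpair.1 j.unpair.2)
  let p : ℕ → Y → X := fun j => f j.unpair.1 ∘ s
  have hpm : ∀ j, Measurable (p j) := fun j => (hf _).2.1.comp hs
  have hPm : ∀ j, MeasurableSet (P j) := fun j => (h𝒜 _).inter (hs ((hf _).1.inter (hH _ _)))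
  have hpi : ∀ j, InjOn (p j) (P j) := fun j a ha b hb hab =>
    hsi _ ha.1 hb.1 ((hf _).2.2.1 ha.2.1 hb.2.1 hab)
  obtain ⟨Q, hQm, hQP, hQA, hQd, hQd', hmax⟩ := greedy hpm hPm hpi hA
  have hsQm : ∀ j, MeasurableSet (s '' Q j) := fun j =>
    (hQm j).image_of_measurable_injOn hs ((hsi _).mono fun y hy => (hQP j hy).1)
  have hpQm : ∀ j, MeasurableSet (p j '' Q j) := fun j =>
    (hQm j).image_of_measurable_injOn (hpm j) ((hpi _).mono (hQP j))
  -- the image is small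
  have hsmall : μ (⋃ j, p j '' Q j) < μ A := by
    have h1 : ∀ n m, μ (p (Nat.pair n m) '' Q (Nat.pair n m)) ≤
        c m * μ (s '' Q (Nat.pair n m)) := by
      intro n m
      have := hH1 n m (s '' Q (Nat.pair n m)) (hsQm _) (by
        rintro _ ⟨y, hy, rfl⟩
        have := (hQP _ hy).2
        simpa using this)
      refine le_trans (le_of_eq ?_) this
      congr 1
      simp [p, image_image]
    have h2 : ∀ m, ∑' n, μ (s '' Q (Nat.pair n m)) ≤ μ univ := by
      intro m
      rw [← measure_iUnion _ fun n => hsQm _]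
      · exact measure_mono (subset_univ _)
      · intro a b hab
        refine Set.disjoint_left.2 ?_
        rintro _ ⟨y, hy, rfl⟩ ⟨z, hz, hzy⟩
        have hy1 := (hQP _ hy).1
        have hz1 := (hQP _ hz).1
        simp only [Nat.unpair_pair] at hy1 hz1
        have := hsi m hz1 hy1 hzy
        subst this
        refine Set.disjoint_left.1 (hQd (i := Nat.pair a m) (j := Nat.pair b m) ?_) hy hz
        intro h
        exact hab (Nat.pair_eq_pair.1 h).1
    calc μ (⋃ j, p j '' Q j) ≤ ∑' j, μ (p j '' Q j) := measure_iUnion_le _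
      _ = ∑' q : ℕ × ℕ, μ (p (Nat.pair q.1 q.2) '' Q (Nat.pair q.1 q.2)) :=
          (Equiv.tsum_eq Nat.pairEquiv (fun j => μ (p j '' Q j))).symm
      _ ≤ ∑' q : ℕ × ℕ, c q.2 * μ (s '' Q (Nat.pair q.1 q.2)) :=
          ENNReal.tsum_le_tsum fun q => h1 q.1 q.2
      _ = ∑' n, ∑' m, c m * μ (s '' Q (Nat.pair n m)) :=
          ENNReal.tsum_prod (f := fun n m => c m * μ (s '' Q (Nat.pair n m)))
      _ = ∑' m, ∑' n, c m * μ (s '' Q (Nat.pair n m)) := ENNReal.tsum_comm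
      _ ≤ ∑' m, c m * μ univ := ENNReal.tsum_le_tsum fun m => by
          rw [ENNReal.tsum_mul_left]; exact mul_le_mul_right (h2 m) _
      _ = (∑' m, c m) * μ univ := ENNReal.tsum_mul_right
      _ < μ A := ENNReal.mul_lt_of_lt_div hcs
  have hR' : MeasurableSet (A \ ⋃ j, p j '' Q j) := hA.diff (MeasurableSet.iUnion hpQm)
  have hR0' : μ (A \ ⋃ j, p j '' Q j) ≠ 0 := by
    intro h0
    have := measure_le_inter_add_sdiff μ A (⋃ j, p j '' Q j)
    rw [h0, add_zero] at this
    exact absurd (this.trans (measure_mono inter_subset_right)) (not_le.2 hsmall)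
  obtain ⟨φ, hφ, hφQ⟩ := exists_measurable_piecewise Q hQm p hpm (by
    intro i j hij
    have := Set.disjoint_iff_inter_eq_empty.1 (hQd hij)
    intro y hy
    rw [this] at hy
    exact hy.elim)
  have hD₀ : MeasurableSet (⋃ j, Q j) := MeasurableSet.iUnion hQm
  refine ⟨φ, ⋃ j, Q j, hφ, hD₀, ?_, ?_, ?_, ?_, ?_⟩
  · exact iUnion_subset fun j y hy => mem_iUnion.2 ⟨_, (hQP j hy).1⟩
  · intro y hy z hz hyz
    obtain ⟨i, hi⟩ := mem_iUnion.1 hy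
    obtain ⟨j, hj⟩ := mem_iUnion.1 hz
    rw [hφQ i hi, hφQ j hj] at hyz
    by_cases hij : i = j
    · subst hij
      exact hpi i (hQP i hi) (hQP i hj) hyz
    · exact (Set.disjoint_left.1 (hQd' hij) ⟨y, hi, rfl⟩ ⟨z, hj, hyz.symm⟩).elim
  · intro y hy
    obtain ⟨i, hi⟩ := mem_iUnion.1 hy
    rw [hφQ i hi]
    exact hQA i hi
  · intro y hy
    obtain ⟨i, hi⟩ := mem_iUnion.1 hy
    rw [hφQ i hi]
    exact hF.2.1.symm ((hf _).2.2.2 _ (hQP i hi).2.1)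
  · intro m
    by_contra h0
    have hR : MeasurableSet (s '' (𝒜 m \ ⋃ j, Q j)) :=
      ((h𝒜 m).diff hD₀).image_of_measurable_injOn hs ((hsi m).mono sdiff_subset)
    refine keyK hF hns herg hIII hf hcov hR hR' h0 hR0' (hc0 m).ne' (hc1 m) ?_
    intro n B hB hBs
    refine hH2 n m B hB fun x hx => ?_
    obtain ⟨⟨⟨y, hy, rfl⟩, hxD⟩, hxA, hxn⟩ := hBs hx
    refine ⟨hxD, fun hxH => ?_⟩
    have hyP : y ∈ P (Nat.pair n m) := by
      refine ⟨?_, ?_, ?_⟩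
      · simpa using hy.1
      · simpa using hxD
      · simpa using hxH
    rcases hmax (Nat.pair n m) y hyP (by simpa [p] using hxA) with h | h
    · exact hy.2 h
    · refine hxn ?_
      simpa [p] using h

end EVB

namespace EVB

theorem sb {Y X : Type*} [MeasurableSpace Y] [StandardBorelSpace Y]
    [MeasurableSpace X] [StandardBorelSpace X] [Nonempty X]
    {α : Set Y} {β : Set X} (hα : MeasurableSet α) (hβ : MeasurableSet β)
    {φ : Y → X} {ψ : X → Y} (hφ : Measurable φ) (hψ : Measurable ψ)
    (hφm : MapsTo φ α β) (hψm : MapsTo ψ β α) (hφi : InjOn φ α) (hψi : InjOn ψ β) :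
    ∃ h : Y → X, Measurable h ∧ BijOn h α β ∧
      ∀ y ∈ α, h y = φ y ∨ (h y ∈ β ∧ ψ (h y) = y) := by
  obtain ⟨g, hg, hgψ⟩ := inv_ext hψ hβ hψi
  let Z : ℕ → Set Y := fun n => Nat.rec (α \ ψ '' β) (fun _ S => ψ '' (φ '' S)) n
  have hZs : ∀ n, Z (n + 1) = ψ '' (φ '' Z n) := fun n => rfl
  have hZ : ∀ n, MeasurableSet (Z n) ∧ Z n ⊆ α := by
    intro n
    induction n with
    | zero => exact ⟨hα.diff (hβ.image_of_measurable_injOn hψ hψi), sdiff_subset⟩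
    | succ n ih =>
      rw [hZs]
      have h1 : φ '' Z n ⊆ β := (hφm.mono_left ih.2).image_subset
      refine ⟨(ih.1.image_of_measurable_injOn hφ (hφi.mono ih.2)).image_of_measurable_injOn hψ
        (hψi.mono h1), (hψm.mono_left h1).image_subset⟩
  have hUm : MeasurableSet (⋃ n, Z n) := MeasurableSet.iUnion fun n => (hZ n).1
  have hoff : ∀ y ∈ α, y ∉ (⋃ n, Z n) → ∃ x ∈ β, ψ x = y := by
    intro y hy hyZ
    by_contra hcon
    exact hyZ (mem_iUnion.2 ⟨0, hy, fun ⟨x, hx, hxy⟩ => hcon ⟨x, hx, hxy⟩⟩)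
  classical
  let h : Y → X := (⋃ n, Z n).piecewise φ g
  have h1 : ∀ y ∈ (⋃ n, Z n), h y = φ y := fun y hy => piecewise_eq_of_mem _ _ _ hy
  have h2 : ∀ y ∈ α, y ∉ (⋃ n, Z n) → h y ∈ β ∧ ψ (h y) = y := by
    intro y hy hyZ
    obtain ⟨x, hx, rfl⟩ := hoff y hy hyZ
    have : h (ψ x) = g (ψ x) := piecewise_eq_of_notMem _ _ _ hyZ
    rw [this, hgψ x hx]
    exact ⟨hx, rfl⟩
  have key : ∀ y ∈ (⋃ n, Z n), ∀ z ∈ α, z ∉ (⋃ n, Z n) → h y ≠ h z := by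
    intro y hy z hz hzZ heq
    obtain ⟨n, hn⟩ := mem_iUnion.1 hy
    have := (h2 z hz hzZ).2
    rw [← heq, h1 y hy] at this
    exact hzZ (mem_iUnion.2 ⟨n + 1, φ y, ⟨y, hn, rfl⟩, this⟩)
  refine ⟨h, Measurable.piecewise hUm hφ hg, ⟨?_, ?_, ?_⟩, ?_⟩
  · intro y hy
    by_cases hyZ : y ∈ ⋃ n, Z n
    · rw [h1 y hyZ]; exact hφm hy
    · exact (h2 y hy hyZ).1
  · intro y hy z hz hyz
    by_cases hyZ : y ∈ ⋃ n, Z n <;> by_cases hzZ : z ∈ ⋃ n, Z n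
    · rw [h1 y hyZ, h1 z hzZ] at hyz
      exact hφi hy hz hyz
    · exact (key y hyZ z hz hzZ hyz).elim
    · exact (key z hzZ y hy hyZ hyz.symm).elim
    · rw [← (h2 y hy hyZ).2, ← (h2 z hz hzZ).2, hyz]
  · intro x hx
    by_cases hyZ : ψ x ∈ ⋃ n, Z n
    · obtain ⟨n, hn⟩ := mem_iUnion.1 hyZ
      cases n with
      | zero => exact (hn.2 ⟨x, hx, rfl⟩).elim
      | succ n =>
        obtain ⟨_, ⟨y, hy, rfl⟩, hyx⟩ := hn
        have := hψi (hφm ((hZ n).2 hy)) hx hyx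
        exact ⟨y, (hZ n).2 hy, by rw [h1 y (mem_iUnion.2 ⟨n, hy⟩), this]⟩
    · have := h2 _ (hψm hx) hyZ
      exact ⟨ψ x, hψm hx, hψi this.1 hx this.2⟩
  · intro y hy
    by_cases hyZ : y ∈ ⋃ n, Z n
    · exact Or.inl (h1 y hyZ)
    · exact Or.inr (h2 y hy hyZ)

section
variable {X : Type*} [MeasurableSpace X]

theorem tsum_one_eq_zero_iff {ι : Type*} : (∑' _ : ι, (1 : ℝ≥0∞)) = 0 ↔ IsEmpty ι := by
  rw [ENNReal.tsum_eq_zero]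
  constructor
  · intro h
    exact ⟨fun i => one_ne_zero (h i)⟩
  · intro h i
    exact (h.false i).elim

theorem nuL_zero_of {μ : Measure X} {S : Set (X × X)} {N : Set X} (hN : μ N = 0)
    (h : ∀ p ∈ S, p.1 ∈ N) : nuL μ S = 0 := by
  unfold nuL lintL
  rw [← lintegral_zero (μ := μ)]
  refine lintegral_congr_ae ?_
  have : ∀ᵐ x ∂μ, x ∉ N := measure_eq_zero_iff_ae_notMem.1 hN
  filter_upwards [this] with x hx
  rw [tsum_one_eq_zero_iff]
  exact ⟨fun y => hx (h _ y.2)⟩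

theorem nuR_zero_of {μ : Measure X} {S : Set (X × X)} {N : Set X} (hN : μ N = 0)
    (h : ∀ p ∈ S, p.2 ∈ N) : nuR μ S = 0 := by
  unfold nuR lintR
  rw [← lintegral_zero (μ := μ)]
  refine lintegral_congr_ae ?_
  have : ∀ᵐ x ∂μ, x ∉ N := measure_eq_zero_iff_ae_notMem.1 hN
  filter_upwards [this] with x hx
  rw [tsum_one_eq_zero_iff]
  exact ⟨fun y => hx (h _ y.2)⟩

theorem one_le_tsum_of {ι : Type*} (i : ι) : (1 : ℝ≥0∞) ≤ ∑' _ : ι, (1 : ℝ≥0∞) :=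
  ENNReal.le_tsum i

theorem zero_of_nuL {μ : Measure X} {S : Set (X × X)} {N : Set X} (hNm : MeasurableSet N)
    (h : ∀ x ∈ N, ∃ y, (x, y) ∈ S) (h0 : nuL μ S = 0) : μ N = 0 := by
  refine le_antisymm ?_ zero_le
  rw [← h0, ← lintegral_indicator_one hNm]
  unfold nuL lintL
  refine lintegral_mono fun x => ?_
  by_cases hx : x ∈ N
  · obtain ⟨y, hy⟩ := h x hx
    rw [indicator_of_mem hx]
    exact one_le_tsum_of (⟨y, hy⟩ : {y : X // (x, y) ∈ S})
  · rw [indicator_of_notMem hx]; exact zero_le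

theorem zero_of_nuR {μ : Measure X} {S : Set (X × X)} {N : Set X} (hNm : MeasurableSet N)
    (h : ∀ x ∈ N, ∃ y, (y, x) ∈ S) (h0 : nuR μ S = 0) : μ N = 0 := by
  refine le_antisymm ?_ zero_le
  rw [← h0, ← lintegral_indicator_one hNm]
  unfold nuR lintR
  refine lintegral_mono fun x => ?_
  by_cases hx : x ∈ N
  · obtain ⟨y, hy⟩ := h x hx
    rw [indicator_of_mem hx]
    exact one_le_tsum_of (⟨y, hy⟩ : {y : X // (y, x) ∈ S})
  · rw [indicator_of_notMem hx]; exact zero_le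

theorem ns_of_mcp [StandardBorelSpace X] {μ : Measure X} {F : Set (X × X)} (h : MCP μ F) :
    NS μ F := by
  intro D f hf
  have hG : MeasurableSet ((fun x => (x, f x)) '' D) :=
    hf.1.image_of_measurable_injOn (measurable_id.prodMk hf.2.1)
      (fun a _ b _ hab => congrArg Prod.fst hab)
  have := h ((fun x => (x, f x)) '' D) (by rintro _ ⟨x, hx, rfl⟩; exact hf.2.2.2 x hx) hG
  constructor
  · intro h0
    refine zero_of_nuR hf.image ?_ (this.1 (nuL_zero_of h0 ?_))
    · rintro _ ⟨x, hx, rfl⟩; exact ⟨x, x, hx, rfl⟩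
    · rintro _ ⟨x, hx, rfl⟩; exact hx
  · intro h0
    refine zero_of_nuL hf.1 ?_ (this.2 (nuR_zero_of h0 ?_))
    · intro x hx; exact ⟨f x, x, hx, rfl⟩
    · rintro _ ⟨x, hx, rfl⟩; exact ⟨x, hx, rfl⟩

end

theorem main {X : Type*} [MeasurableSpace X] [StandardBorelSpace X]
    (μ : Measure X) [SigmaFinite μ]
    (E F : Set (X × X)) (hE : IsCBER E)
    (hF : IsCBER F) (hmcpF : MCP μ F)
    (hergF : ErgodicRel μ F) (hIIIF : IsTypeIII μ F)
    (𝒜 : Set (X × X)) (h𝒜meas : MeasurableSet 𝒜)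
    (h𝒜E : 𝒜 ⊆ E) (h𝒜nn : nuL μ 𝒜 ≠ 0)
    (A : Set X) (hA : MeasurableSet A) (hAnn : μ A ≠ 0) :
    ∃ φ : X × X → X, Measurable φ ∧
      ∃ 𝒜' : Set (X × X), ∃ A' : Set X,
        MeasurableSet 𝒜' ∧ MeasurableSet A' ∧ 𝒜' ⊆ 𝒜 ∧ A' ⊆ A ∧
        nuL μ (𝒜 \ 𝒜') = 0 ∧ μ (A \ A') = 0 ∧
        Set.BijOn φ 𝒜' A' ∧ ∀ e ∈ 𝒜', (φ e, e.1) ∈ F := by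
  have hne : Nonempty X := by
    by_contra h
    rw [not_nonempty_iff] at h
    exact hAnn (by rw [Set.eq_empty_of_isEmpty A, measure_empty])
  have hns0 : NS μ F := ns_of_mcp hmcpF
  have ha := absolutelyContinuous_toFinite μ
  have ha' := toFinite_absolutelyContinuous μ
  have hz : ∀ S, μ.toFinite S = 0 ↔ μ S = 0 := fun S => ⟨fun h => ha h, fun h => ha' h⟩
  have hns : NS μ.toFinite F := by
    intro D f hf
    rw [hz, hz]
    exact hns0 D f hf
  have herg : ErgodicRel μ.toFinite F := by
    intro S hS h
    rw [Ne, hz] at h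
    rw [hz]
    exact hergF S hS h
  have hIII : IsTypeIII μ.toFinite F := by
    rintro ⟨m, h1, h2, h3⟩
    exact hIIIF ⟨m, h1, ⟨h2.1.trans ha', ha.trans h2.2⟩, h3⟩
  -- the pieces
  obtain ⟨P, hPm, hPi, hPU⟩ : ∃ P : ℕ → Set (X × X), (∀ m, MeasurableSet (P m)) ∧
      (∀ m, InjOn Prod.fst (P m)) ∧ ⋃ m, P m = 𝒜 := by
    have := h𝒜meas.standardBorel
    have hc1 : ∀ x, ((fun p : 𝒜 => p.1.1) ⁻¹' {x}).Countable := by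
      intro x
      refine MapsTo.countable_of_injOn (f := fun p : 𝒜 => p.1.2) (t := {y | (x, y) ∈ E}) ?_ ?_
        (hE.2.2 x)
      · rintro ⟨⟨a, b⟩, hp⟩ h
        simp only [mem_preimage, mem_singleton_iff] at h
        subst h; exact h𝒜E hp
      · rintro ⟨⟨a, b⟩, hp⟩ h ⟨⟨a', b'⟩, hp'⟩ h' hh
        simp only [mem_preimage, mem_singleton_iff] at h h' hh
        subst h; subst h'; subst hh; rfl
    obtain ⟨G, hGm, hGi, hGU⟩ := LN (measurable_fst.comp measurable_subtype_coe) hc1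
    refine ⟨fun n => Subtype.val '' G n, fun n =>
      (MeasurableEmbedding.subtype_coe h𝒜meas).measurableSet_image.2 (hGm n), ?_, ?_⟩
    · rintro n _ ⟨a, ha, rfl⟩ _ ⟨b, hb, rfl⟩ hab
      rw [hGi _ ha hb hab]
    · rw [← image_iUnion, hGU, image_univ, Subtype.range_coe]
  have hPim : ∀ m, MeasurableSet (Prod.fst '' P m) := fun m =>
    (hPm m).image_of_measurable_injOn measurable_fst (hPi m)
  obtain ⟨m₀, hm₀⟩ : ∃ m, μ.toFinite (Prod.fst '' P m) ≠ 0 := by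
    by_contra hcon
    push Not at hcon
    refine h𝒜nn (nuL_zero_of (N := ⋃ m, Prod.fst '' P m) ?_ ?_)
    · exact measure_iUnion_null fun m => (hz _).1 (hcon m)
    · intro p hp
      rw [← hPU] at hp
      obtain ⟨m, hm⟩ := mem_iUnion.1 hp
      exact mem_iUnion.2 ⟨m, p, hm, rfl⟩
  obtain ⟨φ, D₁, hφ, hD₁, hD₁s, hφi, hφA, hφF, hφ0⟩ := emb hF hns herg hIII
    measurable_fst hPm hPi hA (by rwa [Ne, hz])
  obtain ⟨ψ, D₂, hψ, hD₂, hD₂s, hψi, hψA, hψF, hψ0⟩ := emb hF hns herg hIII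
    (measurable_id (α := X)) (𝒜 := fun _ => A) (fun _ => hA) (fun _ => injOn_id _)
    (hPim m₀) hm₀
  obtain ⟨g, hg, hgf⟩ := inv_ext measurable_fst (hPm m₀) (hPi m₀)
  obtain ⟨D, f, hf, hcov⟩ := exists_family hF
  let Z : Set X := (⋃ m, Prod.fst '' (P m \ D₁)) ∪ (A \ D₂)
  have hZm : MeasurableSet Z := (MeasurableSet.iUnion fun m =>
    ((hPm m).diff hD₁).image_of_measurable_injOn measurable_fst ((hPi m).mono sdiff_subset)).union
      (hA.diff hD₂)
  have hZ0 : μ Z = 0 := by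
    refine measure_union_null (measure_iUnion_null fun m => (hz _).1 (hφ0 m)) ?_
    have := (hz _).1 (hψ0 0)
    simpa using this
  let N : Set X := ⋃ n, D n ∩ f n ⁻¹' Z
  have hNm : MeasurableSet N :=
    MeasurableSet.iUnion fun n => (hf n).1.inter ((hf n).2.1 hZm)
  have hNmem : ∀ x y, (x, y) ∈ F → y ∈ Z → x ∈ N := by
    intro x y hxy hy
    obtain ⟨n, hn, hn'⟩ := hcov _ hxy
    exact mem_iUnion.2 ⟨n, hn, by rw [mem_preimage, hn']; exact hy⟩
  have hNinv : ∀ x y, (x, y) ∈ F → y ∈ N → x ∈ N := by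
    intro x y hxy hy
    obtain ⟨n, hn, hn'⟩ := mem_iUnion.1 hy
    exact hNmem x (f n y) (hF.2.1.trans hxy ((hf n).2.2.2 y hn)) hn'
  have hZN : Z ⊆ N := fun x hx => hNmem x x (hF.2.1.refl x) hx
  have hN0 : μ N = 0 := by
    refine measure_iUnion_null fun n => ?_
    rw [hns0 _ _ ((hf n).mono ((hf n).1.inter ((hf n).2.1 hZm)) inter_subset_left)]
    refine measure_mono_null ?_ hZ0
    rintro _ ⟨x, hx, rfl⟩
    exact hx.2
  have hα1 : ∀ e ∈ 𝒜 ∩ Prod.fst ⁻¹' Nᶜ, e ∈ D₁ := by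
    rintro e ⟨he, heN⟩
    by_contra hcon
    rw [← hPU] at he
    obtain ⟨m, hm⟩ := mem_iUnion.1 he
    exact heN (hZN (Or.inl (mem_iUnion.2 ⟨m, e, ⟨hm, hcon⟩, rfl⟩)))
  have hβ1 : ∀ x ∈ A \ N, x ∈ D₂ := by
    rintro x ⟨hx, hxN⟩
    by_contra hcon
    exact hxN (hZN (Or.inr ⟨hx, hcon⟩))
  have hgψ : ∀ x ∈ A \ N, g (ψ x) ∈ P m₀ ∧ (g (ψ x)).1 = ψ x := by
    intro x hx
    obtain ⟨e, he, hex⟩ := hψA (hβ1 x hx)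
    rw [← hex, hgf e he]
    exact ⟨he, rfl⟩
  obtain ⟨h, hh, hbij, hor⟩ := sb (α := 𝒜 ∩ Prod.fst ⁻¹' Nᶜ) (β := A \ N) (φ := φ) (ψ := g ∘ ψ)
    (h𝒜meas.inter (measurable_fst hNm.compl)) (hA.diff hNm) hφ (hg.comp hψ)
    (by
      intro e he
      refine ⟨hφA (hα1 e he), fun hN => he.2 ?_⟩
      exact hNinv _ _ (hF.2.1.symm (hφF e (hα1 e he))) hN)
    (by
      intro x hx
      refine ⟨?_, ?_⟩
      · rw [← hPU]; exact mem_iUnion.2 ⟨m₀, (hgψ x hx).1⟩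
      · intro hN
        have hN' : (g (ψ x)).1 ∈ N := hN
        rw [(hgψ x hx).2] at hN'
        exact hx.2 (hNinv _ _ (hF.2.1.symm (hψF x (hβ1 x hx))) hN'))
    (hφi.mono hα1)
    (by
      intro x hx y hy hxy
      have : ψ x = ψ y := by
        rw [← (hgψ x hx).2, ← (hgψ y hy).2]
        exact congrArg Prod.fst hxy
      exact hψi (hβ1 x hx) (hβ1 y hy) this)
  refine ⟨h, hh, 𝒜 ∩ Prod.fst ⁻¹' Nᶜ, A \ N, h𝒜meas.inter (measurable_fst hNm.compl),
    hA.diff hNm, inter_subset_left, sdiff_subset, ?_, ?_, hbij, ?_⟩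
  · refine nuL_zero_of hN0 ?_
    rintro p ⟨hp, hp'⟩
    by_contra hcon
    exact hp' ⟨hp, hcon⟩
  · refine measure_mono_null ?_ hN0
    rintro p ⟨hp, hp'⟩
    by_contra hcon
    exact hp' ⟨hp, hcon⟩
  · intro e he
    rcases hor e he with h1 | ⟨h1, h2⟩
    · rw [h1]; exact hφF e (hα1 e he)
    · have h3 := (hgψ (h e) h1).2
      have h4 : (g (ψ (h e))) = e := h2
      rw [h4] at h3
      rw [h3]
      exact hF.2.1.symm (hψF _ (hβ1 _ h1))

end EVB

/-- Let `(X, μ, E)` be an ergodic mcp type III CBER and `F ⊆ E` an ergodic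
mcp type III subrelation. For any `ν_l`-non-null Borel set `𝒜 ⊆ E ∖ Δ` of directed edges and
any non-null Borel `A ⊆ X`, there is a Borel bijection `φ : 𝒜 → A` (defined up to null sets)
with `(φ(e), s(e)) ∈ F` for a.e. `e ∈ 𝒜`. -/
theorem edge_vertex_bijection {X : Type*} [MeasurableSpace X] [StandardBorelSpace X]
    (μ : Measure X) [SigmaFinite μ]
    (E F : Set (X × X)) (hE : IsCBER E) (hmcpE : MCP μ E)
    (hergE : ErgodicRel μ E) (hIIIE : IsTypeIII μ E)
    (hFE : F ⊆ E) (hF : IsCBER F) (hmcpF : MCP μ F)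
    (hergF : ErgodicRel μ F) (hIIIF : IsTypeIII μ F)
    (𝒜 : Set (X × X)) (h𝒜meas : MeasurableSet 𝒜)
    (h𝒜E : 𝒜 ⊆ E \ {p : X × X | p.1 = p.2}) (h𝒜nn : nuL μ 𝒜 ≠ 0)
    (A : Set X) (hA : MeasurableSet A) (hAnn : μ A ≠ 0) :
    ∃ φ : X × X → X, Measurable φ ∧
      ∃ 𝒜' : Set (X × X), ∃ A' : Set X,
        MeasurableSet 𝒜' ∧ MeasurableSet A' ∧ 𝒜' ⊆ 𝒜 ∧ A' ⊆ A ∧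
        nuL μ (𝒜 \ 𝒜') = 0 ∧ μ (A \ A') = 0 ∧
        Set.BijOn φ 𝒜' A' ∧ ∀ e ∈ 𝒜', (φ e, e.1) ∈ F := by
  exact EVB.main μ E F hE hF hmcpF hergF hIIIF 𝒜 h𝒜meas (fun p hp => (h𝒜E hp).1) h𝒜nn A hA hAnn
end
end

section
/- Let (X, μ, G) be a properly ergodic mcp locally countable Borel graph and let 𝒟' ⊆ G be a Borel set of directed edges which is non-null with respect to ν_l. Then there exists a non-null Borel subset 𝒟 ⊆ 𝒟' such that distinct edges of 𝒟 have pairwise disjoint endpoint sets (for distinct e, e' ∈ 𝒟 the two endpoints of e are disjoint from the two endpoints of e') and 𝒟' − 𝒟 is non-null. -/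
open MeasureTheory Set Filter
open scoped ENNReal ENat Topology

noncomputable section

variable {X : Type*}

lemma aux_exists_bound (ν : Measure ℝ) (p : (ℕ → ℕ) → ℝ) (c : ℝ≥0∞) (S : Set (ℕ → ℕ))
    (h : c < ν (p '' S)) (n : ℕ) : ∃ m : ℕ, c < ν (p '' (S ∩ {α | α n ≤ m})) := by
  have h1 : p '' S = ⋃ m : ℕ, p '' (S ∩ {α | α n ≤ m}) := by
    rw [← image_iUnion, ← inter_iUnion]
    congr 1
    ext α
    simp only [mem_inter_iff, mem_iUnion, mem_setOf_eq]
    exact ⟨fun h => ⟨h, α n, le_rfl⟩, fun h => h.1⟩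
  have hm : Monotone fun m : ℕ => p '' (S ∩ {α | α n ≤ m}) := by
    intro a b hab
    apply image_mono
    rintro α ⟨h1, h2⟩
    exact ⟨h1, le_trans (show α n ≤ a from h2) hab⟩
  rw [h1, hm.measure_iUnion] at h
  exact lt_iSup_iff.1 h

lemma aux_exists_seq (ν : Measure ℝ) (p : (ℕ → ℕ) → ℝ) (c : ℝ≥0∞)
    (h : c < ν (range p)) :
    ∃ k : ℕ → ℕ, ∀ n, c < ν (p '' {α | ∀ i < n, α i ≤ k i}) := by
  choose m hm using aux_exists_bound ν p c
  let T : ℕ → {S : Set (ℕ → ℕ) // c < ν (p '' S)} := fun n =>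
    Nat.rec ⟨univ, by rwa [image_univ]⟩
      (fun n S => ⟨S.1 ∩ {α | α n ≤ m S.1 S.2 n}, hm S.1 S.2 n⟩) n
  refine ⟨fun n => m (T n).1 (T n).2 n, fun n => ?_⟩
  have : {α : ℕ → ℕ | ∀ i < n, α i ≤ m (T i).1 (T i).2 i} = (T n).1 := by
    induction n with
    | zero => ext α; simp [T]
    | succ n ih =>
      have : (T (n+1)).1 = (T n).1 ∩ {α | α n ≤ m (T n).1 (T n).2 n} := rfl
      rw [this]
      ext α
      have ihα : (∀ i < n, α i ≤ m (T i).1 (T i).2 i) ↔ α ∈ (T n).1 := by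
        rw [← ih]; rfl
      constructor
      · exact fun h => ⟨ihα.1 fun i hi => h i (hi.trans (Nat.lt_succ_self n)),
          h n (Nat.lt_succ_self n)⟩
      · rintro ⟨h1, h2⟩ i hi
        rcases Nat.lt_succ_iff_lt_or_eq.1 hi with hi | rfl
        · exact ihα.2 h1 i hi
        · exact h2
  rw [this]
  exact (T n).2

lemma aux_compact (k : ℕ → ℕ) : IsCompact {α : ℕ → ℕ | ∀ i, α i ≤ k i} := by
  have : {α : ℕ → ℕ | ∀ i, α i ≤ k i} = Set.pi univ fun i => Iic (k i) := by
    ext α; simp [Pi.le_def]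
  rw [this]
  exact isCompact_univ_pi fun i => (finite_Iic (k i)).isCompact

lemma aux_open (k : ℕ → ℕ) (V : Set (ℕ → ℕ)) (hV : IsOpen V)
    (h : {α : ℕ → ℕ | ∀ i, α i ≤ k i} ⊆ V) :
    ∃ n : ℕ, {α : ℕ → ℕ | ∀ i < n, α i ≤ k i} ⊆ V := by
  by_contra! hc
  have : ∀ n, ∃ α : ℕ → ℕ, (∀ i < n, α i ≤ k i) ∧ α ∉ V := by
    intro n
    obtain ⟨α, h1, h2⟩ := not_subset.1 (hc n)
    exact ⟨α, h1, h2⟩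
  choose α h1 h2 using this
  obtain ⟨β, hβ, φ, hφ, hlim⟩ := (aux_compact k).tendsto_subseq
    (x := fun n i => min (α n i) (k i)) (fun n i => min_le_right _ _)
  have hlim2 : Tendsto (fun n => α (φ n)) atTop (𝓝 β) := by
    rw [tendsto_pi_nhds] at hlim ⊢
    intro i
    refine (hlim i).congr' ?_
    filter_upwards [eventually_gt_atTop i] with n hn
    exact min_eq_left (h1 (φ n) i (hn.trans_le (hφ.id_le n)))
  have := hV.isClosed_compl.mem_of_tendsto hlim2 (Eventually.of_forall fun n => h2 (φ n))
  exact this (h hβ)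

lemma aux_real (ν : Measure ℝ) [IsFiniteMeasure ν] (Q : Set (ℝ × ℝ)) (hQ : MeasurableSet Q)
    (h : ν (Prod.fst '' Q) ≠ 0) :
    ∃ C : Set ℝ, MeasurableSet C ∧ ν C ≠ 0 ∧ ∃ f : ℝ → ℝ, Measurable f ∧
      ∀ x ∈ C, (x, f x) ∈ Q := by
  have hA := hQ.analyticSet
  rw [AnalyticSet] at hA
  rcases hA with rfl | ⟨φ, hφ, rfl⟩
  · simp at h
  rw [← range_comp] at h
  set p := Prod.fst ∘ φ with hp
  have hpc : Continuous p := continuous_fst.comp hφ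
  obtain ⟨c, hc0, hc⟩ := exists_between (pos_iff_ne_zero.2 h)
  obtain ⟨k, hk⟩ := aux_exists_seq ν p c hc
  set K := {α : ℕ → ℕ | ∀ i, α i ≤ k i} with hKdef
  have hK : IsCompact K := aux_compact k
  have hL : IsCompact (φ '' K) := hK.image hφ
  have hC : IsCompact (p '' K) := hK.image hpc
  have hCp : Prod.fst '' (φ '' K) = p '' K := by rw [image_image]; rfl
  have hν : c ≤ ν (p '' K) := by
    by_contra! hlt
    obtain ⟨U, hU, hUo, hUc⟩ := Set.exists_isOpen_lt_of_lt (p '' K) c hlt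
    obtain ⟨n, hn⟩ := aux_open k (p ⁻¹' U) (hUo.preimage hpc) (image_subset_iff.1 hU)
    have := (hk n).trans_le (measure_mono (image_subset_iff.2 hn))
    exact absurd (this.trans hUc) (lt_irrefl _)
  refine ⟨p '' K, hC.measurableSet, (hc0.trans_le hν).ne', 
    fun x => sInf {y | (x, y) ∈ φ '' K}, ?_, ?_⟩
  all_goals
    have hsec : ∀ x, IsCompact {y | (x, y) ∈ φ '' K} := by
      intro x
      have : {y | (x, y) ∈ φ '' K} = Prod.snd '' (φ '' K ∩ {q | q.1 = x}) := by
        ext y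
        constructor
        · intro h; exact ⟨(x, y), ⟨h, rfl⟩, rfl⟩
        · rintro ⟨⟨a, b⟩, ⟨h1, h2⟩, h3⟩
          simp only [mem_setOf_eq] at h2 h3
          subst h2; subst h3; exact h1
      rw [this]
      exact (hL.inter_right (isClosed_eq continuous_fst continuous_const)).image continuous_snd
    have hmem : ∀ x ∈ p '' K, (x, sInf {y | (x, y) ∈ φ '' K}) ∈ φ '' K := by
      intro x hx
      rw [← hCp] at hx
      obtain ⟨⟨a, b⟩, hab, rfl⟩ := hx
      exact (hsec a).sInf_mem ⟨b, hab⟩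
  · apply measurable_of_Iic
    intro t
    have hm1 : MeasurableSet (Prod.fst '' (φ '' K ∩ {q | q.2 ≤ t})) :=
      ((hL.inter_right (isClosed_le continuous_snd continuous_const)).image
        continuous_fst).measurableSet
    have : (fun x => sInf {y | (x, y) ∈ φ '' K}) ⁻¹' Iic t =
        Prod.fst '' (φ '' K ∩ {q | q.2 ≤ t}) ∪ ((p '' K)ᶜ ∩ {_x | 0 ≤ t}) := by
      ext x
      simp only [mem_preimage, mem_Iic, mem_union]
      by_cases hx : x ∈ p '' K
      · constructor
        · intro h
          exact Or.inl ⟨_, ⟨hmem x hx, h⟩, rfl⟩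
        · rintro (⟨⟨a, b⟩, ⟨h1, h2⟩, rfl⟩ | h)
          · exact (csInf_le (hsec a).bddBelow h1).trans h2
          · exact absurd hx h.1
      · have he : {y | (x, y) ∈ φ '' K} = ∅ := by
          rw [eq_empty_iff_forall_notMem]
          intro y hy
          apply hx
          rw [← hCp]
          exact ⟨(x, y), hy, rfl⟩
        rw [he, Real.sInf_empty]
        constructor
        · intro h; exact Or.inr ⟨hx, h⟩
        · rintro (⟨⟨a, b⟩, ⟨h1, h2⟩, rfl⟩ | h)
          · exact absurd (hCp ▸ mem_image_of_mem Prod.fst h1) hx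
          · exact h.2
    rw [this]
    exact hm1.union (hC.measurableSet.compl.inter (MeasurableSet.const _))
  · intro x hx
    exact image_subset_range _ _ (hmem x hx)

lemma aux_unif {X : Type*} [MeasurableSpace X] [StandardBorelSpace X]
    (μ : Measure X) [SigmaFinite μ] (A : Set (X × X)) (hA : MeasurableSet A)
    (h : nuL μ A ≠ 0) :
    ∃ B : Set X, MeasurableSet B ∧ μ B ≠ 0 ∧ ∃ f : X → X, Measurable f ∧
      ∀ x ∈ B, (x, f x) ∈ A := by
  unfold nuL lintL at h
  obtain ⟨g, hg, hgf, hgi⟩ := exists_measurable_le_lintegral_eq (μ := μ)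
    (fun x => ∑' y : {y : X // (x, y) ∈ A}, (1 : ℝ≥0∞))
  rw [hgi, Ne, lintegral_eq_zero_iff hg] at h
  have hB : MeasurableSet {x | g x ≠ 0} := hg (measurableSet_singleton 0).compl
  have hBμ : 0 < μ {x | g x ≠ 0} := pos_iff_ne_zero.2 h
  obtain ⟨B0, hB0m, hB0s, hB0p, hB0f⟩ : ∃ B0, MeasurableSet B0 ∧ B0 ⊆ {x | g x ≠ 0} ∧
      0 < μ B0 ∧ μ B0 < ∞ := by
    obtain ⟨t, h1, h2, h3, h4⟩ := Measure.exists_subset_measure_lt_top hB hBμ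
    exact ⟨t, h1, h2, h3, h4⟩
  have hne : ∀ x ∈ B0, ∃ y, (x, y) ∈ A := by
    intro x hx
    by_contra! hc
    have : IsEmpty {y : X // (x, y) ∈ A} := ⟨fun y => hc y.1 y.2⟩
    have h2 := hgf x
    simp only [tsum_empty] at h2
    exact hB0s hx (le_antisymm h2 zero_le)
  have hXne : Nonempty X := by
    obtain ⟨x, hx⟩ := nonempty_of_measure_ne_zero hB0p.ne'
    exact ⟨x⟩
  have he := measurableEmbedding_embeddingReal X
  set e := embeddingReal X with hedef
  have : Fact (μ B0 < ∞) := ⟨hB0f⟩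
  have hee : MeasurableEmbedding (Prod.map e e) := he.prodMap he
  obtain ⟨C, hC, hCν, f, hf, hfC⟩ := aux_real (Measure.map e (μ.restrict B0))
    (Prod.map e e '' A) (hee.measurableSet_image.2 hA) (by
      have : e '' B0 ⊆ Prod.fst '' (Prod.map e e '' A) := by
        rintro _ ⟨x, hx, rfl⟩
        obtain ⟨y, hy⟩ := hne x hx
        exact ⟨_, ⟨_, hy, rfl⟩, rfl⟩
      refine fun h0 => hB0p.ne' ?_
      have h1 := measure_mono_null this h0
      rw [he.map_apply, preimage_image_eq _ he.injective, Measure.restrict_apply hB0m,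
        inter_self] at h1
      exact h1)
  refine ⟨e ⁻¹' C, he.measurable hC, ?_, fun x => he.invFun (f (e x)), ?_, ?_⟩
  · intro h0
    apply hCν
    rw [he.map_apply]
    exact le_antisymm ((Measure.restrict_apply_le _ _).trans h0.le) zero_le
  · exact he.measurable_invFun.comp (hf.comp he.measurable)
  · intro x hx
    obtain ⟨⟨a, b⟩, hab, heq⟩ := hfC _ hx
    simp only [Prod.map_apply, Prod.mk.injEq] at heq
    have h1 := he.injective heq.1
    subst h1
    show (a, he.invFun (f (e a))) ∈ A
    rw [← heq.2, he.leftInverse_invFun b]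
    exact hab

lemma aux_nuR_eq {X : Type*} [MeasurableSpace X] (μ : Measure X) (A : Set (X × X)) :
    nuR μ A = nuL μ (Prod.swap ⁻¹' A) := rfl

lemma aux_nuL_ne {X : Type*} [MeasurableSpace X] (μ : Measure X) (A : Set (X × X))
    (B : Set X) (hB : MeasurableSet B) (hμ : μ B ≠ 0) (f : X → X)
    (hf : ∀ x ∈ B, (x, f x) ∈ A) : nuL μ A ≠ 0 := by
  intro h
  apply hμ
  rw [← lintegral_indicator_one hB]
  refine le_antisymm (le_trans (lintegral_mono fun x => ?_) h.le) zero_le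
  by_cases hx : x ∈ B
  · rw [indicator_of_mem hx]
    exact ENNReal.le_tsum (f := fun _ : {y : X // (x, y) ∈ A} => (1 : ℝ≥0∞)) ⟨f x, hf x hx⟩
  · rw [indicator_of_notMem hx]; exact zero_le

lemma aux_split {X : Type*} [MeasurableSpace X] [StandardBorelSpace X]
    (μ : Measure X) (hat : ∀ x, μ {x} = 0) (C : Set X) (hC : MeasurableSet C) (h : μ C ≠ 0) :
    ∃ U, MeasurableSet U ∧ μ (C ∩ U) ≠ 0 ∧ μ (C \ U) ≠ 0 := by
  by_contra! hc
  have hXne : Nonempty X := by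
    obtain ⟨x, hx⟩ := nonempty_of_measure_ne_zero h
    exact ⟨x⟩
  obtain ⟨x, hx⟩ := Filter.exists_singleton_mem_of_forall_separating (l := ae (μ.restrict C))
    MeasurableSet (fun U hU => by
      simp only [mem_ae_iff, Measure.restrict_apply hU.compl, compl_compl,
        Measure.restrict_apply hU]
      by_cases h0 : μ (C ∩ U) = 0
      · right; rwa [inter_comm]
      · left; have := hc U hU h0; rwa [inter_comm, ← diff_eq])
  rw [mem_ae_iff, Measure.restrict_apply (measurableSet_singleton x).compl] at hx
  apply h
  refine measure_mono_null (t := ({x}ᶜ ∩ C) ∪ {x}) ?_ (measure_union_null hx (hat x))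
  intro y hy
  by_cases hyx : y = x
  · exact Or.inr hyx
  · exact Or.inl ⟨hyx, hy⟩

/-- In a properly ergodic mcp locally countable Borel graph `G`, every
`ν_l`-non-null Borel set `𝒟' ⊆ G` of directed edges contains a non-null Borel subset `𝒟`
whose distinct edges have pairwise disjoint endpoints and with `𝒟' ∖ 𝒟` non-null. -/
theorem matching_subset_of_edges {X : Type*} [MeasurableSpace X] [StandardBorelSpace X]
    (μ : Measure X) [SigmaFinite μ]
    (G : Set (X × X)) (hGmeas : MeasurableSet G)
    (hGirr : ∀ x : X, (x, x) ∉ G)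
    (hGsymm : ∀ x y : X, (x, y) ∈ G → (y, x) ∈ G)
    (hGlc : ∀ x : X, {y | (x, y) ∈ G}.Countable)
    (hmcp : MCP μ (connRel G))
    (hpe : ProperlyErgodicRel μ (connRel G))
    (𝒟' : Set (X × X)) (h𝒟'meas : MeasurableSet 𝒟') (h𝒟'G : 𝒟' ⊆ G)
    (h𝒟'nn : nuL μ 𝒟' ≠ 0) :
    ∃ 𝒟 : Set (X × X), MeasurableSet 𝒟 ∧ 𝒟 ⊆ 𝒟' ∧
      nuL μ 𝒟 ≠ 0 ∧ nuL μ (𝒟' \ 𝒟) ≠ 0 ∧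
      ∀ e ∈ 𝒟, ∀ e' ∈ 𝒟, e ≠ e' →
        ({e.1, e.2} ∩ {e'.1, e'.2} : Set X) = ∅ := by
  have hGE : G ⊆ connRel G := fun p hp => Relation.ReflTransGen.single hp
  have hEs : ∀ x y, (x, y) ∈ connRel G → (y, x) ∈ connRel G := by
    intro x y h
    have : Std.Symm (fun a b => (a, b) ∈ G) := ⟨fun a b h => hGsymm a b h⟩
    exact Relation.ReflTransGen.stdSymm.symm _ _ h
  have hat : ∀ x, μ {x} = 0 := by
    intro x
    by_contra h
    apply hpe.2 x
    refine measure_mono_null ?_ (hpe.1 {x} (measurableSet_singleton x) h)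
    rintro y hy ⟨z, rfl, hz⟩
    exact hy (hEs _ _ hz)
  obtain ⟨B, hB, hBμ, f, hf, hfB⟩ := aux_unif μ 𝒟' h𝒟'meas h𝒟'nn
  set D1 : Set (X × X) := {p | p.1 ∈ B ∧ p.2 = f p.1} with hD1
  have hD1m : MeasurableSet D1 :=
    (measurable_fst hB).inter (measurableSet_eq_fun measurable_snd (hf.comp measurable_fst))
  have hD1s : D1 ⊆ 𝒟' := by
    rintro ⟨x, y⟩ ⟨hx, hy⟩
    simp only at hx hy
    subst hy
    exact hfB x hx
  have h1 : nuL μ D1 ≠ 0 := aux_nuL_ne μ D1 B hB hBμ f fun x hx => ⟨hx, rfl⟩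
  have h2 : nuR μ D1 ≠ 0 := fun h =>
    h1 ((hmcp D1 (hD1s.trans (h𝒟'G.trans hGE)) hD1m).2 h)
  rw [aux_nuR_eq] at h2
  obtain ⟨C, hC, hCμ, g, hg, hgC⟩ := aux_unif μ _ (measurable_swap hD1m) h2
  have hgC' : ∀ y ∈ C, (g y, y) ∈ D1 := hgC
  have he := measurableEmbedding_embeddingReal X
  set e := embeddingReal X with hedef
  have hq : ∃ C0 ⊆ C, MeasurableSet C0 ∧ μ C0 ≠ 0 ∧ ∀ y ∈ C0, ∀ z ∈ C0, g y ≠ z := by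
    by_contra! hc
    apply hCμ
    have ha : ∀ q : ℚ, μ (C ∩ {y | e (g y) < q ∧ (q : ℝ) < e y}) = 0 := by
      intro q
      by_contra h0
      obtain ⟨y, hy, z, hz, hyz⟩ := hc _ inter_subset_left (hC.inter
        ((measurableSet_lt (he.measurable.comp hg) measurable_const).inter
          (measurableSet_lt measurable_const he.measurable))) h0
      have h1 : e (g y) < q := hy.2.1
      have h2 : (q : ℝ) < e z := hz.2.2
      rw [hyz] at h1
      exact absurd (h1.trans h2) (lt_irrefl _)
    have hb : ∀ q : ℚ, μ (C ∩ {y | e y < q ∧ (q : ℝ) < e (g y)}) = 0 := by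
      intro q
      by_contra h0
      obtain ⟨y, hy, z, hz, hyz⟩ := hc _ inter_subset_left (hC.inter
        ((measurableSet_lt he.measurable measurable_const).inter
          (measurableSet_lt measurable_const (he.measurable.comp hg)))) h0
      have h1 : (q : ℝ) < e (g y) := hy.2.2
      have h2 : e z < q := hz.2.1
      rw [hyz] at h1
      exact absurd (h1.trans h2) (lt_irrefl _)
    refine measure_mono_null ?_ (measure_union_null (measure_iUnion_null ha)
      (measure_iUnion_null hb))
    intro y hy
    have hne : g y ≠ y := by
      intro h
      have := h𝒟'G (hD1s (hgC' y hy))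
      rw [h] at this
      exact hGirr y this
    rcases lt_or_gt_of_ne (fun h => hne (he.injective h)) with h | h
    · obtain ⟨q, hq1, hq2⟩ := exists_rat_btwn h
      exact Or.inl (mem_iUnion.2 ⟨q, hy, hq1, hq2⟩)
    · obtain ⟨q, hq1, hq2⟩ := exists_rat_btwn h
      exact Or.inr (mem_iUnion.2 ⟨q, hy, hq1, hq2⟩)
  obtain ⟨C0, hC0s, hC0m, hC0μ, hdis⟩ := hq
  obtain ⟨U, hU, hU1, hU2⟩ := aux_split μ hat C0 hC0m hC0μ
  set D : Set (X × X) := {p | p.2 ∈ C0 ∩ U ∧ p.1 = g p.2} with hD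
  have hDm : MeasurableSet D := (measurable_snd (hC0m.inter hU)).inter
    (measurableSet_eq_fun measurable_fst (hg.comp measurable_snd))
  have hDs : D ⊆ 𝒟' := by
    rintro ⟨x, y⟩ ⟨hy, hx⟩
    simp only at hx hy
    subst hx
    exact hD1s (hgC' y (hC0s hy.1))
  refine ⟨D, hDm, hDs, ?_, ?_, ?_⟩
  · intro h
    refine aux_nuL_ne μ (Prod.swap ⁻¹' D) (C0 ∩ U) (hC0m.inter hU) hU1 g
      (fun y hy => ⟨hy, rfl⟩) ?_
    rw [← aux_nuR_eq]
    exact (hmcp D (hDs.trans (h𝒟'G.trans hGE)) hDm).1 h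
  · intro h
    refine aux_nuL_ne μ (Prod.swap ⁻¹' (𝒟' \ D)) (C0 \ U) (hC0m.diff hU) hU2 g
      (fun y hy => ⟨hD1s (hgC' y (hC0s hy.1)), fun h => hy.2 h.1.2⟩) ?_
    rw [← aux_nuR_eq]
    exact (hmcp _ (diff_subset.trans (h𝒟'G.trans hGE)) (h𝒟'meas.diff hDm)).1 h
  · rintro ⟨x, y⟩ ⟨hy, hx⟩ ⟨x', y'⟩ ⟨hy', hx'⟩ hne
    simp only at hx hy hx' hy'
    have hyy : y ≠ y' := by
      rintro rfl
      exact hne (by rw [hx, hx'])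
    have hxx : x ≠ x' := by
      intro h
      have e1 : y = f (g y) := (hgC' y (hC0s hy.1)).2
      have e2 : y' = f (g y') := (hgC' y' (hC0s hy'.1)).2
      exact hyy (by rw [e1, e2, ← hx, ← hx', h])
    have hxy : x ≠ y' := hx ▸ hdis y hy.1 y' hy'.1
    have hyx : y ≠ x' := fun h => hdis y' hy'.1 y hy.1 (by rw [← hx', h])
    rw [eq_empty_iff_forall_notMem]
    rintro z ⟨h1, h2⟩
    simp only [mem_insert_iff, mem_singleton_iff] at h1 h2
    rcases h1 with rfl | rfl <;> rcases h2 with h | h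
    · exact hxx h
    · exact hxy h
    · exact hyx h
    · exact hyy h
end
end
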